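/- arXiv:2403.03453 — 12 statements merged into one kernel-verified Lean document; each statement's English description precedes it below -/
import Mathlib

section
/- Let X be a real Banach space and Y a closed linear subspace of X. Then Y has property-(wU) in X if and only if for any bounded linear functionals x₁*, x₂* ∈ X* such that there exists y ∈ Y with ‖y‖ = 1 and ‖x₁*‖ = ‖x₂*‖ = |x₁*(y)| = |x₂*(y)|, and such that x₁* + x₂* ∈ Y^⊥, one has x₁* + x₂* = 0. -/
open scoped ENNReal

noncomputable section

/-- The annihilator of a subspace `Y` in the continuous dual. -/
def annih {X : Type*} [NormedAddCommGroup X] [NormedSpace ℝ X] (Y : Submodule ℝ X) :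
    Submodule ℝ (X →L[ℝ] ℝ) where
  carrier := {f | ∀ y ∈ Y, f y = 0}
  add_mem' := by intro f g hf hg y hy; simp [hf y hy, hg y hy]
  zero_mem' := by intro y hy; simp
  smul_mem' := by intro c f hf y hy; simp [hf y hy]

/-- `F` is a norm-preserving extension of `f : Y* → ℝ`. -/
def IsNPExtension {X : Type*} [NormedAddCommGroup X] [NormedSpace ℝ X] (Y : Submodule ℝ X)
    (f : Y →L[ℝ] ℝ) (F : X →L[ℝ] ℝ) : Prop :=
  (∀ y : Y, F y = f y) ∧ ‖F‖ = ‖f‖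

/-- property-(U) -/
def PropU {X : Type*} [NormedAddCommGroup X] [NormedSpace ℝ X] (Y : Submodule ℝ X) : Prop :=
  ∀ f : Y →L[ℝ] ℝ, ∃! F : X →L[ℝ] ℝ, IsNPExtension Y f F

/-- property-(wU) -/
def PropwU {X : Type*} [NormedAddCommGroup X] [NormedSpace ℝ X] (Y : Submodule ℝ X) : Prop :=
  ∀ f : Y →L[ℝ] ℝ, (∃ y₀ : Y, ‖y₀‖ = 1 ∧ ‖f‖ = |f y₀|) →
    ∃! F : X →L[ℝ] ℝ, IsNPExtension Y f F

/-- property-(SU) -/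
def PropSU {X : Type*} [NormedAddCommGroup X] [NormedSpace ℝ X] (Y : Submodule ℝ X) : Prop :=
  ∃ G : Submodule ℝ (X →L[ℝ] ℝ), IsClosed (G : Set (X →L[ℝ] ℝ)) ∧ IsCompl G (annih Y) ∧
    ∀ g ∈ G, ∀ h ∈ annih Y, h ≠ 0 → ‖g‖ < ‖g + h‖

/-- property-(HB) -/
def PropHB {X : Type*} [NormedAddCommGroup X] [NormedSpace ℝ X] (Y : Submodule ℝ X) : Prop :=
  ∃ G : Submodule ℝ (X →L[ℝ] ℝ), IsClosed (G : Set (X →L[ℝ] ℝ)) ∧ IsCompl G (annih Y) ∧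
    ∀ g ∈ G, ∀ h ∈ annih Y, h ≠ 0 → ‖g‖ < ‖g + h‖ ∧ ‖h‖ ≤ ‖g + h‖

/-- M-ideal -/
def MIdeal {X : Type*} [NormedAddCommGroup X] [NormedSpace ℝ X] (Y : Submodule ℝ X) : Prop :=
  ∃ G : Submodule ℝ (X →L[ℝ] ℝ), IsClosed (G : Set (X →L[ℝ] ℝ)) ∧ IsCompl G (annih Y) ∧
    ∀ g ∈ G, ∀ h ∈ annih Y, ‖g + h‖ = ‖g‖ + ‖h‖



theorem stmt0 {X : Type*} [NormedAddCommGroup X] [NormedSpace ℝ X] [CompleteSpace X]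
    (Y : Submodule ℝ X) (hY : IsClosed (Y : Set X)) :
    PropwU Y ↔
      ∀ f₁ f₂ : X →L[ℝ] ℝ,
        (∃ y : Y, ‖y‖ = 1 ∧ ‖f₁‖ = ‖f₂‖ ∧ ‖f₁‖ = |f₁ y| ∧ ‖f₂‖ = |f₂ y|) →
        f₁ + f₂ ∈ annih Y → f₁ + f₂ = 0 := by
  constructor
  · rintro hU f₁ f₂ ⟨y, hy, h12, h1, h2⟩ hann
    have hneg : ∀ z : Y, (-f₂) (z : X) = f₁ z := by
      intro z
      have h : (f₁ + f₂) (z : X) = 0 := hann z z.2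
      simp only [_root_.add_apply] at h
      simp only [_root_.neg_apply]
      linarith
    let g : Y →L[ℝ] ℝ := f₁.comp Y.subtypeL
    have hg : ∀ z : Y, g z = f₁ z := fun z => rfl
    have hle : ‖g‖ ≤ ‖f₁‖ := by
      refine ContinuousLinearMap.opNorm_le_bound _ (norm_nonneg _) ?_
      intro z
      exact f₁.le_opNorm (z : X)
    have hge : ‖f₁‖ ≤ ‖g‖ := by
      have h := g.le_opNorm y
      rw [hy, mul_one, hg, Real.norm_eq_abs] at h
      rw [h1]
      exact h
    have hn : ‖f₁‖ = ‖g‖ := le_antisymm hge hle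
    have he := (hU g ⟨y, hy, by rw [← hn, hg]; exact h1⟩).unique
      (y₁ := f₁) (y₂ := -f₂) ⟨fun z => rfl, hn⟩
      ⟨fun z => hneg z, by rw [norm_neg, ← h12, hn]⟩
    rw [he]
    simp
  · rintro h f ⟨y, hy, hf⟩
    obtain ⟨F, hF, hFn⟩ := exists_extension_norm_eq Y f
    refine ⟨F, ⟨hF, hFn⟩, ?_⟩
    rintro G ⟨hG, hGn⟩
    have h0 := h G (-F) ⟨y, hy, by rw [norm_neg, hGn, hFn], by rw [hGn, hG, hf],
      by rw [norm_neg, _root_.neg_apply, abs_neg, hFn, hF, hf]⟩ (by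
        intro z hz
        have h1 := hG ⟨z, hz⟩
        have h2 := hF ⟨z, hz⟩
        simp only at h1 h2
        simp [h1, h2])
    rwa [← sub_eq_add_neg, sub_eq_zero] at h0

end
end

section
/- Let X be a real Banach space and Y a closed linear subspace of X having the 1½-ball property in X. Then Y has property-(wU) in X if and only if Y has property-(U) in X. -/
open scoped ENNReal

noncomputable section

/-- The 1½-ball property of a subspace. -/
def OneHalfBall {X : Type*} [NormedAddCommGroup X] [NormedSpace ℝ X] (Y : Submodule ℝ X) : Prop :=
  ∀ y ∈ Y, ∀ x : X, ∀ r₁ r₂ : ℝ, 0 < r₁ → 0 < r₂ → ‖x - y‖ < r₁ + r₂ →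
    (Metric.closedBall x r₂ ∩ (Y : Set X)).Nonempty →
    (Metric.closedBall y r₁ ∩ Metric.closedBall x r₂ ∩ (Y : Set X)).Nonempty


theorem aux_ekeland {E : Type*} [NormedAddCommGroup E] [NormedSpace ℝ E] [CompleteSpace E]
    (f : E →L[ℝ] ℝ) (ε : ℝ) (hε : 0 < ε) :
    ∃ z : E, ‖z‖ ≤ 1 ∧ ∀ w : E, ‖w‖ ≤ 1 → f w - f z ≤ ε * ‖w - z‖ := by
  have hbd : ∀ w : E, ‖w‖ ≤ 1 → f w ≤ ‖f‖ := fun w hw => by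
    have h1 := f.le_opNorm w
    have h2 := le_abs_self (f w)
    rw [Real.norm_eq_abs] at h1
    nlinarith [norm_nonneg f]
  have step : ∀ (n : ℕ) (y : {y : E // ‖y‖ ≤ 1}), ∃ y' : {y : E // ‖y‖ ≤ 1},
      ε * ‖(y' : E) - y‖ ≤ f y' - f y ∧
      ∀ w : E, ‖w‖ ≤ 1 → ε * ‖w - y‖ ≤ f w - f y → f w ≤ f y' + (1/2 : ℝ)^n := by
    intro n y
    let S : Set ℝ := {t | ∃ w : E, ‖w‖ ≤ 1 ∧ ε * ‖w - y‖ ≤ f w - f y ∧ f w = t}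
    have hne : S.Nonempty := ⟨f y, y, y.2, by simp, rfl⟩
    have hb : BddAbove S := ⟨‖f‖, by rintro t ⟨w, hw, -, rfl⟩; exact hbd w hw⟩
    obtain ⟨t, ⟨w, hw, hw2, rfl⟩, hlt⟩ := exists_lt_of_lt_csSup hne
      (show sSup S - (1/2 : ℝ)^n < sSup S by linarith [show (0:ℝ) < (1/2 : ℝ)^n by positivity])
    refine ⟨⟨w, hw⟩, hw2, fun v hv hv2 => ?_⟩
    have := le_csSup hb (show f v ∈ S from ⟨v, hv, hv2, rfl⟩)
    linarith
  choose nxt h1 h2 using step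
  let u : ℕ → {y : E // ‖y‖ ≤ 1} := fun n => Nat.rec (motive := fun _ => {y : E // ‖y‖ ≤ 1}) ⟨0, by simp⟩ (fun k y => nxt k y) n
  have hu : ∀ n, u (n+1) = nxt n (u n) := fun n => rfl
  have hmono1 : ∀ n k : ℕ, ε * ‖(u (n+k)).1 - (u n).1‖ ≤ f (u (n+k)).1 - f (u n).1 := by
    intro n k
    induction k with
    | zero => simp
    | succ k ih =>
      have := h1 (n+k) (u (n+k))
      rw [← hu] at this
      have tri := norm_sub_le_norm_sub_add_norm_sub (u (n+k+1)).1 (u (n+k)).1 (u n).1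
      rw [← add_assoc]
      nlinarith
  have hmono : ∀ n m : ℕ, n ≤ m → ε * ‖(u m).1 - (u n).1‖ ≤ f (u m).1 - f (u n).1 := by
    intro n m h
    obtain ⟨k, rfl⟩ := Nat.exists_eq_add_of_le h
    exact hmono1 n k
  have hm : Monotone (fun n => f (u n).1) := fun n m h => by
    have := hmono n m h
    have h3 : 0 ≤ ε * ‖(u m).1 - (u n).1‖ := by positivity
    show f (u n).1 ≤ f (u m).1
    linarith
  have hbb : BddAbove (Set.range (fun n => f (u n).1)) :=
    ⟨‖f‖, by rintro _ ⟨n, rfl⟩; exact hbd _ (u n).2⟩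
  have hc := (tendsto_atTop_ciSup hm hbb).cauchySeq
  have hcu : CauchySeq (fun n => (u n).1) := by
    rw [Metric.cauchySeq_iff'] at hc ⊢
    intro δ hδ
    obtain ⟨N, hN⟩ := hc (ε * δ) (by positivity)
    refine ⟨N, fun n hn => ?_⟩
    have h4 := hN n hn
    have h5 := hmono N n hn
    rw [Real.dist_eq] at h4
    rw [dist_eq_norm]
    have h6 := le_abs_self (f (u n).1 - f (u N).1)
    exact lt_of_mul_lt_mul_left (by linarith) hε.le
  obtain ⟨z, hz⟩ := cauchySeq_tendsto_of_complete hcu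
  have hfz : Filter.Tendsto (fun n => f (u n).1) Filter.atTop (nhds (f z)) :=
    (f.continuous.tendsto z).comp hz
  have hzn : ‖z‖ ≤ 1 := le_of_tendsto hz.norm (Filter.Eventually.of_forall fun n => (u n).2)
  have hzS : ∀ n : ℕ, ε * ‖z - (u n).1‖ ≤ f z - f (u n).1 := by
    intro n
    refine le_of_tendsto_of_tendsto ((hz.sub_const (u n).1).norm.const_mul ε)
      (hfz.sub_const (f (u n).1)) ?_
    filter_upwards [Filter.eventually_ge_atTop n] with m hmn
    exact hmono n m hmn
  refine ⟨z, hzn, fun w hw => ?_⟩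
  by_contra hcon
  push Not at hcon
  have hle : ∀ n : ℕ, f w ≤ f (u (n+1)).1 + (1/2 : ℝ)^n := by
    intro n
    rw [hu]
    refine h2 n (u n) w hw ?_
    have := hzS n
    have tri := norm_sub_le_norm_sub_add_norm_sub w z (u n).1
    nlinarith
  have hlim : Filter.Tendsto (fun n => f (u (n+1)).1 + (1/2 : ℝ)^n) Filter.atTop
      (nhds (f z + 0)) :=
    ((Filter.tendsto_add_atTop_iff_nat 1).2 hfz).add
      (tendsto_pow_atTop_nhds_zero_of_lt_one (by norm_num) (by norm_num))
  have := ge_of_tendsto' hlim hle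
  have h7 : 0 ≤ ε * ‖w - z‖ := by positivity
  linarith

/-- Bishop-Phelps for the unit ball. -/
theorem aux_bishop_phelps {E : Type*} [NormedAddCommGroup E] [NormedSpace ℝ E] [CompleteSpace E]
    (f : E →L[ℝ] ℝ) (ε : ℝ) (hε : 0 < ε) (hf : ε < ‖f‖) :
    ∃ g : E →L[ℝ] ℝ, ‖f - g‖ ≤ ε ∧ ∃ z : E, ‖z‖ = 1 ∧ ‖g‖ = |g z| := by
  obtain ⟨z, hz, hE⟩ := aux_ekeland f ε hε
  let A : Set (E × ℝ) := {p | ε * ‖p.1‖ < p.2}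
  let B : Set (E × ℝ) := {p | ‖p.1 + z‖ ≤ 1 ∧ p.2 = f p.1}
  have hA : Convex ℝ A := by
    intro p hp q hq a b ha hb hab
    simp only [A, Set.mem_setOf_eq, Prod.fst_add, Prod.snd_add, Prod.smul_fst, Prod.smul_snd,
      smul_eq_mul] at *
    have h1 := norm_add_le (a • p.1) (b • q.1)
    rw [norm_smul, norm_smul, Real.norm_of_nonneg ha, Real.norm_of_nonneg hb] at h1
    have h2 : ε * ‖a • p.1 + b • q.1‖ ≤ a * (ε * ‖p.1‖) + b * (ε * ‖q.1‖) := by nlinarith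
    rcases ha.eq_or_lt with h | h
    · have : b = 1 := by linarith
      subst this; subst h
      linarith
    · have := mul_lt_mul_of_pos_left hp h
      have := mul_le_mul_of_nonneg_left hq.le hb
      linarith
  have hAo : IsOpen A := isOpen_lt (by fun_prop) (by fun_prop)
  have hB : Convex ℝ B := by
    intro p hp q hq a b ha hb hab
    simp only [B, Set.mem_setOf_eq, Prod.fst_add, Prod.snd_add, Prod.smul_fst, Prod.smul_snd,
      smul_eq_mul, map_add, map_smul] at *
    refine ⟨?_, by rw [hp.2, hq.2]⟩
    have : a • p.1 + b • q.1 + z = a • (p.1 + z) + b • (q.1 + z) := by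
      have : z = a • z + b • z := by rw [← add_smul, hab, one_smul]
      nth_rw 1 [this]
      simp only [smul_add]; abel
    rw [this]
    have h1 := norm_add_le (a • (p.1 + z)) (b • (q.1 + z))
    rw [norm_smul, norm_smul, Real.norm_of_nonneg ha, Real.norm_of_nonneg hb] at h1
    nlinarith [hp.1, hq.1]
  have hdis : Disjoint A B := by
    rw [Set.disjoint_left]
    rintro p hp ⟨h1, h2⟩
    have := hE _ h1
    simp only [map_add, add_sub_cancel_right] at this
    simp only [A, Set.mem_setOf_eq] at hp
    linarith
  obtain ⟨φ, u, hφA, hφB⟩ := geometric_hahn_banach_open hA hAo hB hdis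
  set s := φ (0, 1) with hs
  have hdec : ∀ w t, φ (w, t) = φ (w, 0) + t * s := by
    intro w t
    have : ((w, t) : E × ℝ) = (w, 0) + t • (0, 1) := by simp
    rw [this, map_add, map_smul, smul_eq_mul]
  have hu0 : u ≤ 0 := by
    have := hφB (0, 0) (by simp [B, hz])
    have h0 : φ ((0 : E), (0 : ℝ)) = 0 := map_zero φ
    linarith
  have hu1 : 0 ≤ u := by
    by_contra hneg
    push Not at hneg
    have key : ∀ t : ℝ, 0 < t → t * s < u := by
      intro t ht
      have := hφA (0, t) (by simpa [A] using ht)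
      have h0 : φ ((0 : E), (0 : ℝ)) = 0 := map_zero φ
      rw [hdec, h0] at this
      linarith
    have k1 := key 1 one_pos
    have hsn : s < 0 := by linarith
    have := key (u / (2 * s)) (div_pos_of_neg_of_neg hneg (by linarith))
    have h9 : u / (2 * s) * s = u / 2 := by
      have := hsn.ne
      field_simp
    rw [h9] at this
    linarith
  have hu : u = 0 := le_antisymm hu0 hu1
  subst hu
  have hsn : s < 0 := by
    exact hφA (0, 1) (by simp [A])
  let h : E →L[ℝ] ℝ := (-s)⁻¹ • (φ.comp (ContinuousLinearMap.inl ℝ E ℝ))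
  have hh : ∀ w, φ (w, 0) = (-s) * h w := by
    intro w
    simp only [h, ContinuousLinearMap.smul_apply, ContinuousLinearMap.comp_apply,
      ContinuousLinearMap.inl_apply, smul_eq_mul]
    rw [mul_inv_cancel_left₀ (by linarith)]
  have hle : ∀ w, h w ≤ ε * ‖w‖ := by
    intro w
    refine le_of_forall_gt fun t ht => ?_
    have := hφA (w, t) ht
    rw [hdec, hh] at this
    nlinarith
  have hnorm : ‖h‖ ≤ ε := by
    refine h.opNorm_le_bound hε.le fun w => ?_
    rw [Real.norm_eq_abs, abs_le]
    have := hle (-w)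
    rw [map_neg, norm_neg] at this
    exact ⟨by linarith, hle w⟩
  have hmax : ∀ y : E, ‖y‖ ≤ 1 → (f - h) y ≤ (f - h) z := by
    intro y hy
    have := hφB (y - z, f (y - z)) (by simp [B, hy])
    rw [hdec, hh, map_sub, map_sub] at this
    simp only [ContinuousLinearMap.sub_apply]
    nlinarith
  have hgn : 0 < ‖f - h‖ := by
    have := norm_sub_norm_le f h
    linarith
  have hgz0 : 0 ≤ (f - h) z := by simpa using hmax 0 (by simp)
  have hgle : ‖f - h‖ ≤ (f - h) z := by
    refine ContinuousLinearMap.opNorm_le_of_unit_norm hgz0 fun y hy => ?_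
    rw [Real.norm_eq_abs, abs_le]
    have h1 := hmax (-y) (by rw [norm_neg, hy])
    rw [map_neg] at h1
    exact ⟨by linarith, hmax y hy.le⟩
  have hub := (f - h).le_opNorm z
  rw [Real.norm_eq_abs, abs_of_nonneg hgz0] at hub
  refine ⟨f - h, by simpa using hnorm, z, ?_, ?_⟩
  · nlinarith
  · rw [abs_of_nonneg hgz0]
    nlinarith

theorem aux_ext {X : Type*} [NormedAddCommGroup X] [NormedSpace ℝ X]
    (Y : Submodule ℝ X) (g : Y →L[ℝ] ℝ) (x : X) (hx : x ∉ Y) (c : ℝ)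
    (h1 : ∀ y : Y, g y - ‖g‖ * ‖x - y‖ ≤ c) (h2 : ∀ y : Y, c ≤ ‖g‖ * ‖x - y‖ + g y) :
    ∃ F : X →L[ℝ] ℝ, IsNPExtension Y g F ∧ F x = c := by
  let p : X →ₗ.[ℝ] ℝ := ⟨Y, g.toLinearMap⟩
  have hx' : x ∉ p.domain := hx
  let q := p.supSpanSingleton x c hx'
  obtain ⟨F, hF1, hF2⟩ := exists_extension_of_le_sublinear q (fun v => ‖g‖ * ‖v‖)
    (fun t ht v => by simp only [norm_smul, Real.norm_of_nonneg ht.le]; ring)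
    (fun v w => by
      have := norm_add_le v w
      have := mul_le_mul_of_nonneg_left this (norm_nonneg g)
      linarith) (by
      rintro ⟨v, hv⟩
      obtain ⟨y, hy, w, hw, rfl⟩ := Submodule.mem_sup.1 hv
      obtain ⟨t, rfl⟩ := Submodule.mem_span_singleton.1 hw
      have e := p.supSpanSingleton_apply_mk x c hx' y hy t
      refine e.le.trans ?_
      show g ⟨y, hy⟩ + t * c ≤ ‖g‖ * ‖y + t • x‖
      rcases lt_trichotomy t 0 with ht | ht | ht
      · have := h1 ((-t)⁻¹ • ⟨y, hy⟩)
        have e2 : y + t • x = t • (x - (-t)⁻¹ • y) := by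
          rw [smul_sub, smul_smul, inv_neg, mul_neg, mul_inv_cancel₀ ht.ne]; simp [add_comm]
        rw [e2, norm_smul, Real.norm_of_nonpos ht.le]
        simp only [map_smul, smul_eq_mul, Submodule.coe_smul] at this
        have h3 := mul_le_mul_of_nonneg_left this (neg_nonneg.2 ht.le)
        rw [mul_sub, mul_inv_cancel_left₀ (by linarith)] at h3
        linarith
      · subst ht
        have := (le_abs_self _).trans (g.le_opNorm ⟨y, hy⟩)
        simpa using this
      · have := h2 (-(t⁻¹ • ⟨y, hy⟩))
        have e2 : y + t • x = t • (x - -(t⁻¹ • y)) := by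
          rw [sub_neg_eq_add, smul_add, smul_smul, mul_inv_cancel₀ ht.ne']; simp [add_comm]
        rw [e2, norm_smul, Real.norm_of_nonneg ht.le]
        simp only [map_neg, map_smul, smul_eq_mul, Submodule.coe_smul, Submodule.coe_neg] at this
        have h3 := mul_le_mul_of_nonneg_left this ht.le
        have h4 : t * (t⁻¹ * g ⟨y, hy⟩) = g ⟨y, hy⟩ := mul_inv_cancel_left₀ ht.ne' _
        nlinarith)
  have hb : ∀ v, ‖F v‖ ≤ ‖g‖ * ‖v‖ := by
    intro v
    rw [Real.norm_eq_abs, abs_le]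
    have := hF2 (-v)
    simp only [map_neg, norm_neg] at this
    exact ⟨by linarith, hF2 v⟩
  have hFY : ∀ y : Y, F y = g y := by
    intro y
    have e := hF1 ⟨y, Submodule.mem_sup_left y.2⟩
    exact e.trans (p.supSpanSingleton_apply_mk_of_mem c hx' y.2)
  refine ⟨F.mkContinuous ‖g‖ hb, ⟨hFY, le_antisymm ?_ ?_⟩, ?_⟩
  · exact LinearMap.mkContinuous_norm_le _ (norm_nonneg g) _
  · refine g.opNorm_le_bound (norm_nonneg _) fun y => ?_
    rw [← hFY y]
    exact (F.mkContinuous ‖g‖ hb).le_opNorm (y : X)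
  · exact (hF1 ⟨x, _⟩).trans (p.supSpanSingleton_apply_self c hx')

theorem aux_gap {X : Type*} [NormedAddCommGroup X] [NormedSpace ℝ X]
    (Y : Submodule ℝ X) (g : Y →L[ℝ] ℝ) (x : X) (hx : x ∉ Y)
    (hg : ∃! F : X →L[ℝ] ℝ, IsNPExtension Y g F) (η : ℝ) (hη : 0 < η) :
    ∃ y y' : Y, ‖g‖ * ‖x - y‖ + g y ≤ g y' - ‖g‖ * ‖x - y'‖ + η := by
  by_contra hcon
  push Not at hcon
  have hbd : BddAbove (Set.range fun y : Y => g y - ‖g‖ * ‖x - y‖) := by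
    refine ⟨‖g‖ * ‖x - (0 : Y)‖ + g 0, ?_⟩
    rintro _ ⟨y, rfl⟩
    have := hcon 0 y
    show g y - ‖g‖ * ‖x - y‖ ≤ _
    linarith
  set a := ⨆ y : Y, g y - ‖g‖ * ‖x - y‖ with ha
  have hl : ∀ y : Y, g y - ‖g‖ * ‖x - y‖ ≤ a := fun y => le_ciSup hbd y
  have hr : ∀ y : Y, a + η ≤ ‖g‖ * ‖x - y‖ + g y := by
    intro y
    have : a ≤ ‖g‖ * ‖x - y‖ + g y - η := ciSup_le fun y' => by linarith [hcon y y']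
    linarith
  obtain ⟨F, hF, hFx⟩ := aux_ext Y g x hx a hl (fun y => by linarith [hr y])
  obtain ⟨G, hG, hGx⟩ := aux_ext Y g x hx (a + η) (fun y => by linarith [hl y]) hr
  have := hg.unique hF hG
  rw [this] at hFx
  linarith

theorem aux_near {X : Type*} [NormedAddCommGroup X] [NormedSpace ℝ X]
    (Y : Submodule ℝ X) (hball : OneHalfBall Y) (x : X) (d η : ℝ) (hd : 0 ≤ d) (hη : 0 < η)
    (hlow : ∀ y : Y, d ≤ ‖x - y‖) (hup : ∃ y : Y, ‖x - y‖ ≤ d + η) (y : Y) :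
    ∃ p : Y, ‖x - p‖ ≤ d + η ∧ ‖p - y‖ ≤ ‖x - y‖ - d + η := by
  obtain ⟨y1, hy1⟩ := hup
  obtain ⟨p, ⟨hp1, hp2⟩, hp3⟩ := hball y y.2 x (‖x - y‖ - d + η) (d + η)
    (by linarith [hlow y]) (by linarith) (by linarith)
    ⟨y1, by rw [Metric.mem_closedBall, dist_comm, dist_eq_norm]; exact hy1, y1.2⟩
  refine ⟨⟨p, hp3⟩, ?_, ?_⟩
  · rw [Metric.mem_closedBall, dist_comm, dist_eq_norm] at hp2; exact hp2
  · rw [Metric.mem_closedBall, dist_eq_norm] at hp1; exact hp1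

theorem aux_le {X : Type*} [NormedAddCommGroup X] [NormedSpace ℝ X] [CompleteSpace X]
    (Y : Submodule ℝ X) (hY : IsClosed (Y : Set X)) (hball : OneHalfBall Y) (hw : PropwU Y)
    (f : Y →L[ℝ] ℝ) (F G : X →L[ℝ] ℝ) (hF : IsNPExtension Y f F) (hG : IsNPExtension Y f G)
    (hf : 0 < ‖f‖) (x : X) (hx : x ∉ Y) : F x ≤ G x := by
  haveI : CompleteSpace Y := hY.completeSpace_coe
  obtain ⟨d, hd0, hlow, hup⟩ : ∃ d : ℝ, 0 ≤ d ∧ (∀ y : Y, d ≤ ‖x - y‖) ∧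
      ∀ η : ℝ, 0 < η → ∃ y : Y, ‖x - y‖ ≤ d + η := by
    refine ⟨⨅ y : Y, ‖x - y‖, Real.iInf_nonneg fun y => norm_nonneg _, fun y =>
      ciInf_le ⟨0, by rintro _ ⟨y, rfl⟩; exact norm_nonneg _⟩ y, fun η hη => ?_⟩
    obtain ⟨y, hy⟩ := exists_lt_of_ciInf_lt
      (show (⨅ y : Y, ‖x - y‖) < (⨅ y : Y, ‖x - y‖) + η by linarith)
    exact ⟨y, hy.le⟩
  have main : ∀ η : ℝ, 0 < η → η < ‖f‖ → η < 1 →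
      F x - G x ≤ η * (4 * d + 5 + 4 * ‖f‖ + 2) := by
    intro η hη hηf hη1
    obtain ⟨g, hfg, hatt⟩ := aux_bishop_phelps f η hη hηf
    obtain ⟨y, y', hyy⟩ := aux_gap Y g x hx (hw g hatt) η hη
    obtain ⟨p, hp1, hp2⟩ := aux_near Y hball x d η hd0 hη hlow (hup η hη) y
    obtain ⟨q, hq1, hq2⟩ := aux_near Y hball x d η hd0 hη hlow (hup η hη) y'
    have e1 : g p - g y ≤ ‖g‖ * (‖x - y‖ - d + η) := by
      rw [← map_sub]
      exact ((le_abs_self _).trans (g.le_opNorm _)).trans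
        (mul_le_mul_of_nonneg_left hp2 (norm_nonneg _))
    have e2 : g y' - g q ≤ ‖g‖ * (‖x - y'‖ - d + η) := by
      rw [← map_sub]
      refine ((le_abs_self _).trans (g.le_opNorm _)).trans
        (mul_le_mul_of_nonneg_left ?_ (norm_nonneg _))
      rw [norm_sub_rev]; exact hq2
    have hpq : ‖p - q‖ ≤ 2 * (d + η) := by
      have := norm_sub_le_norm_sub_add_norm_sub (p : X) x q
      rw [norm_sub_rev (p : X) x] at this
      have h : ‖p - q‖ = ‖(p : X) - q‖ := rfl
      linarith
    have e3 : (f - g) (p - q) ≤ η * (2 * (d + η)) :=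
      ((le_abs_self _).trans ((f - g).le_opNorm _)).trans
        (mul_le_mul hfg hpq (norm_nonneg _) hη.le)
    simp only [ContinuousLinearMap.sub_apply, map_sub] at e3
    have e4 : F x - f p ≤ ‖f‖ * (d + η) := by
      rw [← hF.1 p, ← map_sub, ← hF.2]
      exact ((le_abs_self _).trans (F.le_opNorm _)).trans
        (mul_le_mul_of_nonneg_left hp1 (norm_nonneg _))
    have e5 : f q - G x ≤ ‖f‖ * (d + η) := by
      rw [← hG.1 q, ← map_sub, ← hG.2]
      refine ((le_abs_self _).trans (G.le_opNorm _)).trans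
        (mul_le_mul_of_nonneg_left ?_ (norm_nonneg _))
      rw [norm_sub_rev]; exact hq1
    have n1 : ‖f‖ - ‖g‖ ≤ η := (norm_sub_norm_le f g).trans hfg
    have n2 : ‖g‖ - ‖f‖ ≤ η := (norm_sub_norm_le g f).trans (by rw [norm_sub_rev]; exact hfg)
    have m1 : (‖f‖ - ‖g‖) * d ≤ η * d := mul_le_mul_of_nonneg_right n1 hd0
    have m2 : (‖g‖ - ‖f‖) * η ≤ η * η := mul_le_mul_of_nonneg_right n2 hη.le
    have m3 : η * η ≤ η := by nlinarith
    nlinarith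
  set C := 4 * d + 5 + 4 * ‖f‖ + 2 with hC
  have hCpos : 0 < C := by positivity
  by_contra hcon
  push Not at hcon
  set δ := F x - G x with hδ
  have hδ0 : 0 < δ := by linarith
  let η := min (min (‖f‖ / 2) (1 / 2)) (δ / (2 * C))
  have k1 : η ≤ ‖f‖ / 2 := (min_le_left _ _).trans (min_le_left _ _)
  have k2 : η ≤ 1 / 2 := (min_le_left _ _).trans (min_le_right _ _)
  have k3 : η ≤ δ / (2 * C) := min_le_right _ _
  have k0 : 0 < η := by positivity
  have := main η k0 (by linarith) (by linarith)
  have k4 : η * C ≤ δ / (2 * C) * C := mul_le_mul_of_nonneg_right k3 hCpos.le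
  have k5 : δ / (2 * C) * C = δ / 2 := by field_simp
  linarith

theorem stmt1 {X : Type*} [NormedAddCommGroup X] [NormedSpace ℝ X] [CompleteSpace X]
    (Y : Submodule ℝ X) (hY : IsClosed (Y : Set X)) (hball : OneHalfBall Y) :
    PropwU Y ↔ PropU Y := by
  refine ⟨fun hw f => ?_, fun h f _ => h f⟩
  obtain ⟨F, hF⟩ := exists_extension_norm_eq Y f
  have hF' : IsNPExtension Y f F := hF
  refine ⟨F, hF', fun G hG => ?_⟩
  rcases (norm_nonneg f).eq_or_lt with h0 | hpos
  · have h1 := hF.2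
    have h2 := hG.2
    rw [← h0, norm_eq_zero] at h1 h2
    rw [h1, h2]
  · ext x
    by_cases hx : x ∈ Y
    · exact (hG.1 ⟨x, hx⟩).trans (hF.1 ⟨x, hx⟩).symm
    · exact le_antisymm (aux_le Y hY hball hw f G F hG hF' hpos x hx)
        (aux_le Y hY hball hw f F G hF' hG hpos x hx)

end
end

section
/- Let X be a real Banach space, Y a closed linear subspace of X, and Z a linear subspace of X that is dense in X. Then Y has property-(wU) in span(Y ∪ {z}) for every z ∈ Z if and only if Y has property-(wU) in X. -/
open scoped ENNReal

noncomputable section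

theorem propwU_iff_aux {X : Type*} [NormedAddCommGroup X] [NormedSpace ℝ X] (Y : Submodule ℝ X) :
    PropwU Y ↔ ∀ F G : X →L[ℝ] ℝ, (∀ y ∈ Y, F y = G y) → ‖F‖ = ‖G‖ →
      (∃ y ∈ Y, ‖y‖ = 1 ∧ ‖F‖ = |F y|) → F = G := by
  constructor
  · intro h F G hFG hn hy
    obtain ⟨y, hyY, hy1, hyF⟩ := hy
    have hnorm : ‖F‖ = ‖F.comp Y.subtypeL‖ := by
      apply le_antisymm
      · have := (F.comp Y.subtypeL).le_opNorm ⟨y, hyY⟩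
        simp only [Submodule.coe_norm, hy1, mul_one] at this
        rw [hyF]
        exact this
      · refine ContinuousLinearMap.opNorm_le_bound _ (norm_nonneg _) fun x => ?_
        exact F.le_opNorm x
    refine (h (F.comp Y.subtypeL) ⟨⟨y, hyY⟩, hy1, ?_⟩).unique ⟨fun _ => rfl, hnorm⟩
      ⟨fun z => (hFG z z.2).symm, hn ▸ hnorm⟩
    rw [← hnorm]
    exact hyF
  · intro h f hf
    obtain ⟨y, hy1, hyf⟩ := hf
    obtain ⟨F, hF, hFn⟩ := exists_extension_norm_eq Y f
    refine ⟨F, ⟨hF, hFn⟩, fun G hG => ?_⟩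
    refine (h F G (fun z hz => (hF ⟨z, hz⟩).trans (hG.1 ⟨z, hz⟩).symm) (hFn.trans hG.2.symm)
      ⟨y, y.2, hy1, ?_⟩).symm
    rw [hFn, hF, hyf]

theorem stmt2 {X : Type*} [NormedAddCommGroup X] [NormedSpace ℝ X] [CompleteSpace X]
    (Y : Submodule ℝ X) (hY : IsClosed (Y : Set X))
    (Z : Submodule ℝ X) (hZ : Dense (Z : Set X)) :
    (∀ z ∈ Z, PropwU (Y.comap (Y ⊔ Submodule.span ℝ {z}).subtype)) ↔ PropwU Y := by
  simp only [propwU_iff_aux]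
  constructor
  · intro h F G hFG hn hy
    obtain ⟨y, hyY, hy1, hyF⟩ := hy
    have key : ∀ (W : Submodule ℝ X) (H : X →L[ℝ] ℝ), y ∈ W → ‖H‖ = |H y| →
        ‖H.comp W.subtypeL‖ = ‖H‖ := by
      intro W H hW hH
      apply le_antisymm
      · refine ContinuousLinearMap.opNorm_le_bound _ (norm_nonneg _) fun x => ?_
        exact H.le_opNorm x
      · have := (H.comp W.subtypeL).le_opNorm ⟨y, hW⟩
        simp only [Submodule.coe_norm, hy1, mul_one] at this
        rw [hH]
        exact this
    have hyG : ‖G‖ = |G y| := by rw [← hn, hyF, hFG y hyY]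
    have heq : ∀ z ∈ (Z : Set X), F z = G z := by
      intro z hz
      have hYW : Y ≤ Y ⊔ Submodule.span ℝ {z} := le_sup_left
      have hzW : z ∈ Y ⊔ Submodule.span ℝ {z} :=
        Submodule.mem_sup_right (Submodule.mem_span_singleton_self z)
      have := h z hz (F.comp (Y ⊔ Submodule.span ℝ {z}).subtypeL)
        (G.comp (Y ⊔ Submodule.span ℝ {z}).subtypeL) (fun w hw => hFG w hw)
        (by rw [key _ F (hYW hyY) hyF, key _ G (hYW hyY) hyG, hn])
        ⟨⟨y, hYW hyY⟩, hyY, hy1, by rw [key _ F (hYW hyY) hyF]; exact hyF⟩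
      exact congrArg (fun H => H ⟨z, hzW⟩) this
    exact ContinuousLinearMap.coeFn_injective
      (Continuous.ext_on hZ F.continuous G.continuous heq)
  · intro h z _ F G hFG hn hy
    obtain ⟨y, hyY, hy1, hyF⟩ := hy
    obtain ⟨F', hF, hFn⟩ := exists_extension_norm_eq _ F
    obtain ⟨G', hG, hGn⟩ := exists_extension_norm_eq _ G
    have hYW : Y ≤ Y ⊔ Submodule.span ℝ {z} := le_sup_left
    have := h F' G' (fun w hw => by
        rw [hF ⟨w, hYW hw⟩, hG ⟨w, hYW hw⟩]; exact hFG _ hw)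
      (by rw [hFn, hGn, hn]) ⟨y, hyY, hy1, by rw [hFn, hF, hyF]⟩
    ext w
    rw [← hF, ← hG, this]

end
end

section
/- Let X be a real Banach space and Y a closed linear subspace of X. Then Y has property-(HB) in X if and only if Y^# is a closed linear subspace of X*, X* is the algebraic direct sum Y^# ⊕ Y^⊥, and ‖x*‖ ≥ ‖y^⊥‖ whenever x* = y^# + y^⊥ with y^# ∈ Y^# and y^⊥ ∈ Y^⊥. -/
open scoped ENNReal

noncomputable section

/-- The set `Y^#` of functionals whose norm equals the norm of their restriction to `Y`. -/
def sharp {X : Type*} [NormedAddCommGroup X] [NormedSpace ℝ X] (Y : Submodule ℝ X) :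
    Set (X →L[ℝ] ℝ) :=
  {f | ‖f‖ = ‖f.comp Y.subtypeL‖}

theorem stmt3_aux_res {X : Type*} [NormedAddCommGroup X] [NormedSpace ℝ X]
    (Y : Submodule ℝ X) (f : X →L[ℝ] ℝ) : ‖f.comp Y.subtypeL‖ ≤ ‖f‖ := by
  refine ContinuousLinearMap.opNorm_le_bound _ (norm_nonneg _) fun y => ?_
  exact f.le_opNorm (y : X)

theorem stmt3_aux_add {X : Type*} [NormedAddCommGroup X] [NormedSpace ℝ X]
    (Y : Submodule ℝ X) (g h : X →L[ℝ] ℝ) (hh : h ∈ annih Y) :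
    (g + h).comp Y.subtypeL = g.comp Y.subtypeL := by
  ext y
  have : h (y : X) = 0 := hh y y.2
  simp [this]

theorem stmt3 {X : Type*} [NormedAddCommGroup X] [NormedSpace ℝ X] [CompleteSpace X]
    (Y : Submodule ℝ X) (hY : IsClosed (Y : Set X)) :
    PropHB Y ↔
      ∃ G : Submodule ℝ (X →L[ℝ] ℝ), (G : Set (X →L[ℝ] ℝ)) = sharp Y ∧
        IsClosed (sharp Y) ∧ IsCompl G (annih Y) ∧
        ∀ g ∈ G, ∀ h ∈ annih Y, ‖h‖ ≤ ‖g + h‖ := by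
  constructor
  · rintro ⟨G, hc, hG, H⟩
    have key : (G : Set (X →L[ℝ] ℝ)) = sharp Y := by
      ext f
      constructor
      · intro hf
        obtain ⟨F, hF, hn⟩ := _root_.exists_extension_norm_eq Y (f.comp Y.subtypeL)
        have hm : F - f ∈ annih Y := by
          intro y hy
          have := hF ⟨y, hy⟩
          simp at this
          simp [this]
        have h0 : F - f = 0 := by
          by_contra hne
          have h1 := (H f hf _ hm hne).1
          rw [add_sub_cancel, hn] at h1
          exact absurd (stmt3_aux_res Y f) (not_le.mpr h1)
        rw [sub_eq_zero] at h0
        subst h0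
        exact hn
      · intro hf
        have hf' : ‖f‖ = ‖f.comp Y.subtypeL‖ := hf
        have ht : f ∈ G ⊔ annih Y := by rw [hG.sup_eq_top]; trivial
        obtain ⟨g, hg, h, hh, rfl⟩ := Submodule.mem_sup.mp ht
        by_cases hne : h = 0
        · subst hne; simpa using hg
        · have h1 := (H g hg h hh hne).1
          rw [hf', stmt3_aux_add Y g h hh] at h1
          exact absurd (stmt3_aux_res Y g) (not_le.mpr h1)
    refine ⟨G, key, key ▸ hc, hG, fun g hg h hh => ?_⟩
    by_cases hne : h = 0
    · subst hne; simp
    · exact (H g hg h hh hne).2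
  · rintro ⟨G, key, hc, hG, H⟩
    refine ⟨G, key ▸ hc, hG, fun g hg h hh hne => ⟨?_, H g hg h hh⟩⟩
    have hg' : g ∈ sharp Y := key ▸ hg
    have hg2 : ‖g‖ = ‖g.comp Y.subtypeL‖ := hg'
    have h1 := stmt3_aux_res Y (g + h)
    rw [stmt3_aux_add Y g h hh, ← hg2] at h1
    refine lt_of_le_of_ne h1 fun he => hne ?_
    have hs : g + h ∈ sharp Y := by
      change ‖g + h‖ = ‖(g + h).comp Y.subtypeL‖
      rw [stmt3_aux_add Y g h hh, ← hg2, he]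
    rw [← key] at hs
    have hhG : h ∈ G := (Submodule.add_mem_iff_right G hg).mp hs
    exact (Submodule.disjoint_def.mp hG.disjoint) h hhG hh

end
end

section
/- Let X be a real Banach space, Y a closed linear subspace of X, and Z a linear subspace of X that is dense in X. Then Y has property-(HB) in span(Y ∪ {z}) for every z ∈ Z if and only if Y has property-(HB) in X. -/
open scoped ENNReal

noncomputable section

/-- `g` is norm-minimal with respect to `Y`. -/
def SMin {X : Type*} [NormedAddCommGroup X] [NormedSpace ℝ X] (Y : Submodule ℝ X)
    (g : X →L[ℝ] ℝ) : Prop :=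
  ∀ c : ℝ, 0 ≤ c → (∀ y ∈ Y, ‖g y‖ ≤ c * ‖y‖) → ‖g‖ ≤ c

lemma exists_sMin {X : Type*} [NormedAddCommGroup X] [NormedSpace ℝ X] (Y : Submodule ℝ X)
    (g : X →L[ℝ] ℝ) : ∃ e : X →L[ℝ] ℝ, SMin Y e ∧ g - e ∈ annih Y := by
  obtain ⟨e, he, hn⟩ := exists_extension_norm_eq Y (g.comp Y.subtypeL)
  refine ⟨e, ?_, ?_⟩
  · intro c hc hy
    rw [hn]
    refine ContinuousLinearMap.opNorm_le_bound _ hc ?_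
    intro y
    rw [← he y]
    exact hy y y.2
  · intro y hy
    have := he ⟨y, hy⟩
    simp at this
    simp [this]

lemma SMin.le_add {X : Type*} [NormedAddCommGroup X] [NormedSpace ℝ X] {Y : Submodule ℝ X}
    {g h : X →L[ℝ] ℝ} (hg : SMin Y g) (hh : h ∈ annih Y) : ‖g‖ ≤ ‖g + h‖ := by
  refine hg _ (norm_nonneg _) ?_
  intro y hy
  have h1 := (g + h).le_opNorm y
  have h2 : h y = 0 := hh y hy
  simpa [h2] using h1

lemma propHB_iff {X : Type*} [NormedAddCommGroup X] [NormedSpace ℝ X] (Y : Submodule ℝ X) :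
    PropHB Y ↔ (∀ f g, SMin Y f → SMin Y g → SMin Y (f + g)) ∧
      ∀ g, SMin Y g → ∀ h ∈ annih Y, h ≠ 0 → ‖g‖ < ‖g + h‖ ∧ ‖h‖ ≤ ‖g + h‖ := by
  constructor
  · rintro ⟨G, -, hG, H⟩
    have key : ∀ g, SMin Y g ↔ g ∈ G := by
      intro g
      constructor
      · intro hg
        have : g ∈ G ⊔ annih Y := by rw [hG.sup_eq_top]; trivial
        obtain ⟨a, ha, b, hb, rfl⟩ := Submodule.mem_sup.1 this
        by_cases h0 : b = 0
        · simpa [h0] using ha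
        · have h1 := (H a ha b hb h0).1
          have h2 := hg.le_add (neg_mem hb)
          simp at h2
          linarith
      · intro hg
        obtain ⟨e, he, hd⟩ := exists_sMin Y g
        by_cases h0 : g - e = 0
        · rwa [sub_eq_zero.1 h0]
        · have h1 := (H g hg (-(g - e)) (neg_mem hd) (neg_ne_zero.2 h0)).1
          have h2 := he.le_add hd
          simp at h1 h2
          linarith
    refine ⟨fun f g hf hg => ?_, fun g hg => H g ((key g).1 hg)⟩
    rw [key] at *
    exact add_mem hf hg
  · rintro ⟨hadd, H⟩
    let G : Submodule ℝ (X →L[ℝ] ℝ) :=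
      { carrier := {g | SMin Y g}
        add_mem' := fun {f g} hf hg => hadd f g hf hg
        zero_mem' := fun c hc _ => by simpa using hc
        smul_mem' := by
          intro a g hg
          intro c hc hy
          by_cases ha : a = 0
          · simpa [ha] using hc
          have ha' : 0 < ‖a‖ := norm_pos_iff.2 ha
          have h1 : ‖g‖ ≤ c / ‖a‖ := by
            refine hg _ (by positivity) fun y hyY => ?_
            have h2 := hy y hyY
            rw [ContinuousLinearMap.smul_apply, norm_smul] at h2
            rw [div_mul_eq_mul_div, le_div_iff₀ ha']
            linarith
          rw [le_div_iff₀ ha'] at h1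
          rw [norm_smul]
          linarith }
    refine ⟨G, ?_, ⟨?_, ?_⟩, H⟩
    · rw [← closure_subset_iff_isClosed]
      intro g hg c hc hy
      refine le_of_forall_pos_le_add fun ε hε => ?_
      obtain ⟨f, hf, hd⟩ := Metric.mem_closure_iff.1 hg (ε / 2) (by positivity)
      rw [dist_eq_norm] at hd
      have h1 : ‖f‖ ≤ c + ε / 2 := by
        refine hf _ (by positivity) fun y hyY => ?_
        have h2 := (g - f).le_of_opNorm_le hd.le y
        have h3 := hy y hyY
        have h4 : f y = g y - (g - f) y := by simp
        rw [h4]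
        refine (norm_sub_le _ _).trans ?_
        linarith
      have h5 : g = f + (g - f) := by abel
      rw [h5]
      refine (norm_add_le _ _).trans ?_
      linarith
    · rw [Submodule.disjoint_def]
      intro g hg hg'
      have := hg 0 le_rfl (fun y hy => by simp [hg' y hy])
      simpa using this
    · rw [codisjoint_iff, eq_top_iff]
      intro g _
      obtain ⟨e, he, hd⟩ := exists_sMin Y g
      exact Submodule.mem_sup.2 ⟨e, he, g - e, hd, by abel⟩

lemma norm_restr_le {X : Type*} [NormedAddCommGroup X] [NormedSpace ℝ X] (W : Submodule ℝ X)
    (F : X →L[ℝ] ℝ) : ‖F.comp W.subtypeL‖ ≤ ‖F‖ :=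
  ContinuousLinearMap.opNorm_le_bound _ (norm_nonneg _) fun w => F.le_opNorm w

lemma SMin.restr {X : Type*} [NormedAddCommGroup X] [NormedSpace ℝ X] {Y W : Submodule ℝ X}
    (hYW : Y ≤ W) {F : X →L[ℝ] ℝ} (hF : SMin Y F) :
    SMin (Y.comap W.subtype) (F.comp W.subtypeL) := by
  intro c hc hy
  refine (norm_restr_le W F).trans (hF c hc ?_)
  intro y hyY
  exact hy ⟨y, hYW hyY⟩ hyY

lemma SMin.extend {X : Type*} [NormedAddCommGroup X] [NormedSpace ℝ X] {Y W : Submodule ℝ X}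
    (hYW : Y ≤ W) {k : W →L[ℝ] ℝ} (hk : SMin (Y.comap W.subtype) k) :
    ∃ F : X →L[ℝ] ℝ, SMin Y F ∧ F.comp W.subtypeL = k ∧ ‖F‖ = ‖k‖ := by
  obtain ⟨F, hF, hn⟩ := exists_extension_norm_eq W k
  refine ⟨F, ?_, ContinuousLinearMap.ext hF, hn⟩
  intro c hc hy
  rw [hn]
  refine hk c hc ?_
  intro w hw
  rw [← hF w]
  exact hy w hw

lemma norm_le_of_dense {X : Type*} [NormedAddCommGroup X] [NormedSpace ℝ X]
    {Z : Submodule ℝ X} (hZ : Dense (Z : Set X)) {F : X →L[ℝ] ℝ} {c : ℝ} (hc : 0 ≤ c)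
    (h : ∀ z ∈ Z, ‖F z‖ ≤ c * ‖z‖) : ‖F‖ ≤ c := by
  refine ContinuousLinearMap.opNorm_le_bound _ hc fun x => ?_
  have hcl : IsClosed {x : X | ‖F x‖ ≤ c * ‖x‖} := isClosed_le (by fun_prop) (by fun_prop)
  have := closure_minimal (s := (Z : Set X)) h hcl
  exact this (hZ x)

theorem stmt4 {X : Type*} [NormedAddCommGroup X] [NormedSpace ℝ X] [CompleteSpace X]
    (Y : Submodule ℝ X) (hY : IsClosed (Y : Set X))
    (Z : Submodule ℝ X) (hZ : Dense (Z : Set X)) :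
    (∀ z ∈ Z, PropHB (Y.comap (Y ⊔ Submodule.span ℝ {z}).subtype)) ↔ PropHB Y := by
  constructor
  · intro H
    have hYW : ∀ z, Y ≤ Y ⊔ Submodule.span ℝ {z} := fun z => le_sup_left
    have hzW : ∀ z, z ∈ Y ⊔ Submodule.span ℝ {z} := fun z =>
      (le_sup_right : _ ≤ Y ⊔ Submodule.span ℝ {z}) (Submodule.mem_span_singleton_self z)
    have hbd : ∀ (F : X →L[ℝ] ℝ) (z : X),
        ‖F z‖ ≤ ‖F.comp (Y ⊔ Submodule.span ℝ {z}).subtypeL‖ * ‖z‖ := fun F z =>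
      (F.comp (Y ⊔ Submodule.span ℝ {z}).subtypeL).le_opNorm ⟨z, hzW z⟩
    rw [propHB_iff]
    refine ⟨fun f g hf hg c hc hy => ?_, fun g hg h hh h0 => ?_⟩
    · refine norm_le_of_dense hZ hc fun z hz => (hbd _ z).trans ?_
      refine mul_le_mul_of_nonneg_right ?_ (norm_nonneg _)
      have h1 := ((propHB_iff _).1 (H z hz)).1 _ _ (hf.restr (hYW z)) (hg.restr (hYW z))
      exact h1 c hc fun w hw => hy w hw
    · have h2 : ∀ z ∈ Z, h z ≠ 0 →
          ‖g‖ < ‖g + h‖ ∧ ‖h z‖ ≤ ‖g + h‖ * ‖z‖ := by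
        intro z hz hne
        have h3 := ((propHB_iff _).1 (H z hz)).2 _ (hg.restr (hYW z))
          (h.comp (Y ⊔ Submodule.span ℝ {z}).subtypeL) (fun w hw => hh w hw)
          (fun h0 => hne (by simpa using DFunLike.congr_fun h0 ⟨z, hzW z⟩))
        rw [← ContinuousLinearMap.add_comp] at h3
        have h4 := norm_restr_le (Y ⊔ Submodule.span ℝ {z}) (g + h)
        refine ⟨?_, ?_⟩
        · refine lt_of_le_of_lt ?_ (h3.1.trans_le h4)
          refine hg _ (norm_nonneg _) fun y hy => ?_
          exact (g.comp (Y ⊔ Submodule.span ℝ {z}).subtypeL).le_opNorm ⟨y, hYW z hy⟩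
        · exact (hbd h z).trans
            (mul_le_mul_of_nonneg_right (h3.2.trans h4) (norm_nonneg _))
      constructor
      · by_contra hcon
        refine h0 (norm_le_zero_iff.1 (norm_le_of_dense hZ le_rfl fun z hz => ?_))
        by_cases hne : h z = 0
        · simp [hne]
        · exact absurd (h2 z hz hne).1 hcon
      · refine norm_le_of_dense hZ (norm_nonneg _) fun z hz => ?_
        by_cases hne : h z = 0
        · rw [hne, norm_zero]; positivity
        · exact (h2 z hz hne).2
  · intro H z _
    have hYW : Y ≤ Y ⊔ Submodule.span ℝ {z} := le_sup_left
    obtain ⟨hadd, hin⟩ := (propHB_iff _).1 H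
    rw [propHB_iff]
    refine ⟨fun f g hf hg => ?_, fun g hg h hh h0 => ?_⟩
    · obtain ⟨F, hF, rfl, -⟩ := hf.extend hYW
      obtain ⟨K, hK, rfl, -⟩ := hg.extend hYW
      rw [← ContinuousLinearMap.add_comp]
      exact (hadd F K hF hK).restr hYW
    · obtain ⟨F, hF, hFg, hFn⟩ := hg.extend hYW
      obtain ⟨P, hP, hPn⟩ := exists_extension_norm_eq _ (g + h)
      have hPF : (P - F).comp (Y ⊔ Submodule.span ℝ {z}).subtypeL = h := by
        ext w
        have h1 := hP w
        have h2 := DFunLike.congr_fun hFg w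
        simp at h1 h2
        simp [h1, h2]
      have h5 := hin F hF (P - F) (fun y hy => by
          have h6 := DFunLike.congr_fun hPF ⟨y, hYW hy⟩
          rw [hh ⟨y, hYW hy⟩ hy] at h6
          exact h6) (fun h7 => h0 (by rw [← hPF, h7]; simp))
      rw [add_sub_cancel, hPn, hFn] at h5
      refine ⟨h5.1, le_trans ?_ h5.2⟩
      conv_lhs => rw [← hPF]
      exact norm_restr_le _ _

end
end

section
/- Let X be a real Banach space, M an M-summand in X, and Z a closed linear subspace of M having property-(HB) in M. Then Z has property-(HB) in X. -/
open scoped ENNReal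

noncomputable section

/-- `M` is an M-summand in `X`. -/
def IsMSummand {X : Type*} [NormedAddCommGroup X] [NormedSpace ℝ X] (M : Submodule ℝ X) : Prop :=
  ∃ N : Submodule ℝ X, IsClosed (M : Set X) ∧ IsClosed (N : Set X) ∧ IsCompl M N ∧
    ∀ m ∈ M, ∀ n ∈ N, ‖m + n‖ = max ‖m‖ ‖n‖

/-- restriction of functionals -/
def restrF {X : Type*} [NormedAddCommGroup X] [NormedSpace ℝ X] (M : Submodule ℝ X) :
    (X →L[ℝ] ℝ) →L[ℝ] (M →L[ℝ] ℝ) := ContinuousLinearMap.precomp ℝ M.subtypeL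

lemma restrF_apply {X : Type*} [NormedAddCommGroup X] [NormedSpace ℝ X] (M : Submodule ℝ X)
    (f : X →L[ℝ] ℝ) (m : M) : restrF M f m = f m := rfl

lemma restrF_norm_zero {X : Type*} [NormedAddCommGroup X] [NormedSpace ℝ X] (M : Submodule ℝ X)
    (f : X →L[ℝ] ℝ) (h : restrF M f = 0) : ‖restrF M f‖ = 0 := by
  refine le_antisymm ?_ (ContinuousLinearMap.opNorm_nonneg _)
  refine (restrF M f).opNorm_le_bound le_rfl fun x => ?_
  rw [h]; simp

lemma norm_split {X : Type*} [NormedAddCommGroup X] [NormedSpace ℝ X] (M N : Submodule ℝ X)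
    (hc : IsCompl M N) (hn : ∀ m ∈ M, ∀ n ∈ N, ‖m + n‖ = max ‖m‖ ‖n‖) (f : X →L[ℝ] ℝ) :
    ‖f‖ = ‖restrF M f‖ + ‖restrF N f‖ := by
  apply le_antisymm
  · refine f.opNorm_le_bound (by positivity) fun x => ?_
    obtain ⟨m, hm, n, hN, rfl⟩ := Submodule.mem_sup.1
      (hc.sup_eq_top ▸ Submodule.mem_top : x ∈ M ⊔ N)
    rw [map_add, hn m hm n hN, add_mul]
    refine (norm_add_le _ _).trans (add_le_add ?_ ?_)
    · refine ((restrF M f).le_opNorm ⟨m, hm⟩).trans ?_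
      exact mul_le_mul_of_nonneg_left (le_max_left _ _) (norm_nonneg _)
    · refine ((restrF N f).le_opNorm ⟨n, hN⟩).trans ?_
      exact mul_le_mul_of_nonneg_left (le_max_right _ _) (norm_nonneg _)
  · have key0 : ∀ m ∈ M, ∀ n ∈ N, ‖m‖ = 1 → ‖n‖ = 1 → f m + f n ≤ ‖f‖ := by
      intro m hm n hN h1 h2
      have := f.le_opNorm (m + n)
      rw [hn m hm n hN, h1, h2, max_self, mul_one, map_add] at this
      exact (le_abs_self _).trans this
    have key : ∀ m ∈ M, ∀ n ∈ N, ‖m‖ = 1 → ‖n‖ = 1 → |f m| + |f n| ≤ ‖f‖ := by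
      intro m hm n hN h1 h2
      have a1 := key0 m hm n hN h1 h2
      have a2 := key0 (-m) (M.neg_mem hm) n hN (by simpa using h1) h2
      have a3 := key0 m hm (-n) (N.neg_mem hN) h1 (by simpa using h2)
      have a4 := key0 (-m) (M.neg_mem hm) (-n) (N.neg_mem hN) (by simpa using h1)
        (by simpa using h2)
      simp only [map_neg] at a2 a3 a4
      rcases abs_cases (f m) with h | h <;> rcases abs_cases (f n) with h' | h' <;> linarith
    have hMle : ‖restrF M f‖ ≤ ‖f‖ :=
      (restrF M f).opNorm_le_bound (norm_nonneg _) fun x => f.le_opNorm x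
    suffices h : ‖restrF N f‖ ≤ ‖f‖ - ‖restrF M f‖ by linarith
    refine ContinuousLinearMap.opNorm_le_of_unit_norm (by linarith) fun n h2 => ?_
    have hfn : |f n| ≤ ‖f‖ := by
      have := f.le_opNorm (n : X)
      rw [show ‖(n : X)‖ = 1 from h2, mul_one] at this
      exact this
    suffices h : ‖restrF M f‖ ≤ ‖f‖ - |f n| by
      rw [restrF_apply, Real.norm_eq_abs]; linarith
    refine ContinuousLinearMap.opNorm_le_of_unit_norm (by linarith) fun m h1 => ?_
    rw [restrF_apply, Real.norm_eq_abs]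
    linarith [key m m.2 n n.2 h1 h2]

lemma exists_ext {X : Type*} [NormedAddCommGroup X] [NormedSpace ℝ X] (M N : Submodule ℝ X)
    (hc : IsCompl M N) (hn : ∀ m ∈ M, ∀ n ∈ N, ‖m + n‖ = max ‖m‖ ‖n‖) (g : M →L[ℝ] ℝ) :
    ∃ f : X →L[ℝ] ℝ, restrF M f = g ∧ restrF N f = 0 := by
  let P := M.projectionOnto N hc
  have hP : ∀ x, ‖P x‖ ≤ 1 * ‖x‖ := by
    intro x
    obtain ⟨m, hm, n, hN, rfl⟩ := Submodule.mem_sup.1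
      (hc.sup_eq_top ▸ Submodule.mem_top : x ∈ M ⊔ N)
    have h1 : P m = ⟨m, hm⟩ := Submodule.projectionOnto_apply_left hc ⟨m, hm⟩
    have h2 : P n = 0 := Submodule.projectionOnto_apply_right hc ⟨n, hN⟩
    rw [map_add, h1, h2, add_zero, one_mul, hn m hm n hN]
    exact le_max_left _ _
  refine ⟨g.comp (P.mkContinuous 1 hP), ?_, ?_⟩
  · ext m
    exact congrArg g (Submodule.projectionOnto_apply_left hc m)
  · ext n
    exact (congrArg g (Submodule.projectionOnto_apply_right hc n)).trans (map_zero g)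

theorem stmt5 {X : Type*} [NormedAddCommGroup X] [NormedSpace ℝ X] [CompleteSpace X]
    (M : Submodule ℝ X) (hM : IsMSummand M)
    (Z : Submodule ℝ X) (hZM : Z ≤ M) (hZ : IsClosed (Z : Set X))
    (hHB : PropHB (Z.comap M.subtype)) :
    PropHB Z := by
  obtain ⟨N, -, -, hc, hn⟩ := hM
  obtain ⟨G, hGc, hG, hGn⟩ := hHB
  have split := norm_split M N hc hn
  have hann : ∀ f : X →L[ℝ] ℝ, f ∈ annih Z ↔ restrF M f ∈ annih (Z.comap M.subtype) :=
    fun f => ⟨fun h y hy => h y hy, fun h y hy => h ⟨y, hZM hy⟩ hy⟩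
  refine ⟨G.comap (restrF M).toLinearMap ⊓ LinearMap.ker (restrF N).toLinearMap, ?_, ?_, ?_⟩
  · exact (hGc.preimage (restrF M).continuous).inter (restrF N).isClosed_ker
  · constructor
    · rw [Submodule.disjoint_def]
      rintro f ⟨h1, h2⟩ h3
      have h4 : restrF M f = 0 := Submodule.disjoint_def.1 hG.disjoint _ h1 ((hann f).1 h3)
      have h5 : restrF N f = 0 := h2
      rw [← norm_eq_zero, split, restrF_norm_zero M f h4, restrF_norm_zero N f h5, add_zero]
    · rw [codisjoint_iff, eq_top_iff]
      intro f _
      obtain ⟨g, hg, h, hh, hgh⟩ := Submodule.mem_sup.1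
        (hG.sup_eq_top ▸ Submodule.mem_top : restrF M f ∈ G ⊔ annih (Z.comap M.subtype))
      obtain ⟨g', h1, h2⟩ := exists_ext M N hc hn g
      refine Submodule.mem_sup.2 ⟨g', ⟨?_, h2⟩, f - g', ?_, by abel⟩
      · change restrF M g' ∈ G
        rwa [h1]
      · rw [hann, map_sub, h1, ← hgh]
        simpa using hh
  · rintro g ⟨h1, h2⟩ h hh h0
    have h2' : restrF N g = 0 := h2
    have e1 := split g
    have e2 := split (g + h)
    have e3 := split h
    rw [map_add, map_add, h2', zero_add] at e2
    rw [restrF_norm_zero N g h2'] at e1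
    by_cases hM0 : restrF M h = 0
    · have : 0 < ‖h‖ := norm_pos_iff.2 h0
      rw [restrF_norm_zero M h hM0] at e3
      rw [hM0, add_zero] at e2
      have := norm_nonneg (restrF M g)
      constructor <;> linarith
    · obtain ⟨i1, i2⟩ := hGn _ h1 _ ((hann h).1 hh) hM0
      have := norm_nonneg (restrF N h)
      change ‖restrF M g‖ < ‖restrF M g + restrF M h‖ at i1
      change ‖restrF M h‖ ≤ ‖restrF M g + restrF M h‖ at i2
      constructor <;> linarith

end
end

section
/- Let X be a real Banach space and Y a closed linear subspace of X such that every 1-dimensional linear subspace of Y has property-(wU) in X. Then Y has property-(wU) in X. -/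
open scoped ENNReal

noncomputable section

theorem stmt7 {X : Type*} [NormedAddCommGroup X] [NormedSpace ℝ X] [CompleteSpace X]
    (Y : Submodule ℝ X) (hY : IsClosed (Y : Set X))
    (h : ∀ Z : Submodule ℝ X, Z ≤ Y → Module.finrank ℝ Z = 1 → PropwU Z) :
    PropwU Y := by
  intro f ⟨y₀, hy1, hfy⟩
  obtain ⟨G, hG1, hG2⟩ := exists_extension_norm_eq Y f
  have key : ∀ F : X →L[ℝ] ℝ, IsNPExtension Y f F → F = G := by
    intro F hF
    have hy0 : (y₀ : X) ≠ 0 := by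
      intro h0
      have h2 : ‖(y₀ : X)‖ = 1 := hy1
      rw [h0, norm_zero] at h2
      exact zero_ne_one h2
    have hle : Submodule.span ℝ {(y₀ : X)} ≤ Y := by
      rw [Submodule.span_singleton_le_iff_mem]
      exact y₀.2
    have hw := h _ hle (finrank_span_singleton hy0)
    let z : Submodule.span ℝ {(y₀ : X)} := ⟨y₀, Submodule.mem_span_singleton_self _⟩
    have hz : ‖z‖ = 1 := hy1
    let g : Submodule.span ℝ {(y₀ : X)} →L[ℝ] ℝ := G.comp (Submodule.subtypeL _)
    have hgz : g z = f y₀ := hG1 y₀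
    have hg : ‖g‖ = ‖f‖ := by
      apply le_antisymm
      · rw [← hG2]
        refine g.opNorm_le_bound (norm_nonneg _) (fun x => ?_)
        exact G.le_opNorm (x : X)
      · have h3 := g.le_opNorm z
        rw [hz, mul_one, hgz, Real.norm_eq_abs, ← hfy] at h3
        exact h3
    refine (hw g ⟨z, hz, by rw [hg, hgz, hfy]⟩).unique ⟨fun y => ?_, ?_⟩ ⟨fun y => rfl, ?_⟩
    · change F y = G y
      exact (hF.1 ⟨y, hle y.2⟩).trans (hG1 ⟨y, hle y.2⟩).symm
    · rw [hF.2, hg]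
    · rw [hG2, hg]
  exact ⟨G, ⟨hG1, hG2⟩, key⟩
end
end

section
/- Let X be a real Banach space and Y a closed linear subspace of X such that every separable closed linear subspace of Y has property-(U) in X. Then Y has property-(U) in X. -/
open scoped ENNReal

noncomputable section

theorem stmt8 {X : Type*} [NormedAddCommGroup X] [NormedSpace ℝ X] [CompleteSpace X]
    (Y : Submodule ℝ X) (hY : IsClosed (Y : Set X))
    (h : ∀ Z : Submodule ℝ X, Z ≤ Y → IsClosed (Z : Set X) →
      TopologicalSpace.IsSeparable (Z : Set X) → PropU Z) :
    PropU Y := by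
  intro f
  obtain ⟨F₀, hF₀, hF₀n⟩ := exists_extension_norm_eq Y f
  refine ⟨F₀, ⟨hF₀, hF₀n⟩, ?_⟩
  rintro G ⟨hG, hGn⟩
  have hy : ∀ n : ℕ, ∃ y : Y, ‖y‖ < 1 ∧ ‖f‖ - 1 / ((n : ℝ) + 1) < ‖f y‖ := fun n =>
    f.exists_lt_apply_of_lt_opNorm (sub_lt_self _ (by positivity))
  choose y hy1 hy2 using hy
  have hsub : (Set.range fun n => (y n : X)) ⊆ (Y : Set X) := by
    rintro _ ⟨n, rfl⟩
    exact (y n).2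
  let Z : Submodule ℝ X := (Submodule.span ℝ (Set.range fun n => (y n : X))).topologicalClosure
  have hZY : Z ≤ Y := Submodule.topologicalClosure_minimal _ (Submodule.span_le.2 hsub) hY
  have hZc : IsClosed (Z : Set X) := Submodule.isClosed_topologicalClosure _
  have hZs : TopologicalSpace.IsSeparable (Z : Set X) := by
    have h1 : TopologicalSpace.IsSeparable (Set.range fun n => (y n : X)) :=
      (Set.countable_range _).isSeparable
    exact (h1.span (R := ℝ)).closure
  have hyZ : ∀ n, (y n : X) ∈ Z := fun n =>
    Submodule.le_topologicalClosure _ (Submodule.subset_span ⟨n, rfl⟩)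
  let g : Z →L[ℝ] ℝ := F₀.comp Z.subtypeL
  have hg1 : ‖g‖ ≤ ‖f‖ := by
    refine g.opNorm_le_bound (norm_nonneg f) fun z => ?_
    rw [← hF₀n]
    exact F₀.le_opNorm z
  have hg2 : ‖f‖ ≤ ‖g‖ := by
    refine le_of_forall_pos_le_add fun ε hε => ?_
    obtain ⟨n, hn⟩ := exists_nat_one_div_lt hε
    have h1 : ‖f (y n)‖ ≤ ‖g‖ := by
      have h2 := g.le_opNorm ⟨y n, hyZ n⟩
      have h3 : g ⟨y n, hyZ n⟩ = f (y n) := hF₀ (y n)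
      rw [h3] at h2
      exact h2.trans (mul_le_of_le_one_right (norm_nonneg _) (hy1 n).le)
    have := hy2 n
    linarith
  have hgf : ‖g‖ = ‖f‖ := le_antisymm hg1 hg2
  refine (h Z hZY hZc hZs g).unique ⟨fun z => ?_, hGn.trans hgf.symm⟩
    ⟨fun z => rfl, hF₀n.trans hgf.symm⟩
  exact (hG ⟨z, hZY z.2⟩).trans (hF₀ ⟨z, hZY z.2⟩).symm

end
end

section
/- Let X be a real Banach space and Y a closed linear subspace of X such that every separable closed linear subspace of Y has property-(SU) in X. Then Y has property-(SU) in X. -/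
open scoped ENNReal

noncomputable section

/-- Norm of the restriction. -/
def rnorm {X : Type*} [NormedAddCommGroup X] [NormedSpace ℝ X] (Y : Submodule ℝ X)
    (f : X →L[ℝ] ℝ) : ℝ := ‖f.comp Y.subtypeL‖

lemma rnorm_le {X : Type*} [NormedAddCommGroup X] [NormedSpace ℝ X] (Y : Submodule ℝ X)
    (f : X →L[ℝ] ℝ) : rnorm Y f ≤ ‖f‖ := by
  refine ContinuousLinearMap.opNorm_le_bound _ (norm_nonneg _) fun y => ?_
  simpa using f.le_opNorm (y : X)

lemma rnorm_mono {X : Type*} [NormedAddCommGroup X] [NormedSpace ℝ X] {Z Y : Submodule ℝ X}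
    (hZ : Z ≤ Y) (f : X →L[ℝ] ℝ) : rnorm Z f ≤ rnorm Y f := by
  refine ContinuousLinearMap.opNorm_le_bound _ (norm_nonneg (f.comp Y.subtypeL)) fun z => ?_
  exact (f.comp Y.subtypeL).le_opNorm ⟨z, hZ z.2⟩

lemma rnorm_congr {X : Type*} [NormedAddCommGroup X] [NormedSpace ℝ X] (Y : Submodule ℝ X)
    (f h : X →L[ℝ] ℝ) (hh : h ∈ annih Y) : rnorm Y (f + h) = rnorm Y f := by
  unfold rnorm
  congr 1
  ext y
  have : h y = 0 := hh y y.2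
  simp [this]

lemma exists_hb {X : Type*} [NormedAddCommGroup X] [NormedSpace ℝ X] (Y : Submodule ℝ X)
    (f : X →L[ℝ] ℝ) : ∃ h ∈ annih Y, ‖f + h‖ = rnorm Y f := by
  obtain ⟨g, hg, hn⟩ := exists_extension_norm_eq Y (f.comp Y.subtypeL)
  refine ⟨g - f, fun y hy => ?_, by simpa [rnorm] using hn⟩
  have := hg ⟨y, hy⟩
  simp at this
  simp [this]

lemma mem_iff_of_SU {X : Type*} [NormedAddCommGroup X] [NormedSpace ℝ X] (Z : Submodule ℝ X)
    (hZ : PropSU Z) : ∃ G : Submodule ℝ (X →L[ℝ] ℝ), ∀ f, f ∈ G ↔ ‖f‖ = rnorm Z f := by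
  obtain ⟨G, -, hc, hs⟩ := hZ
  refine ⟨G, fun f => ⟨fun hf => ?_, fun hf => ?_⟩⟩
  · obtain ⟨h, hh, hn⟩ := exists_hb Z f
    by_cases h0 : h = 0
    · simpa [h0] using hn
    · have h1 := hs f hf h hh h0
      have h2 := rnorm_le Z f
      linarith
  · have hm : f ∈ G ⊔ annih Z := by rw [hc.sup_eq_top]; trivial
    obtain ⟨g, hg, h, hh, rfl⟩ := Submodule.mem_sup.1 hm
    by_cases h0 : h = 0
    · simpa [h0] using hg
    · have h1 := hs g hg h hh h0
      rw [rnorm_congr Z g h hh] at hf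
      have h2 := rnorm_le Z g
      linarith

lemma exists_countable {X : Type*} [NormedAddCommGroup X] [NormedSpace ℝ X] (Y : Submodule ℝ X)
    (f : X →L[ℝ] ℝ) : ∃ S : Set X, S.Countable ∧ S ⊆ Y ∧
      ∀ Z : Submodule ℝ X, S ⊆ Z → rnorm Y f ≤ rnorm Z f := by
  have key : ∀ n : ℕ, ∃ y : Y, ‖y‖ ≤ 1 ∧ rnorm Y f - 1 / ((n : ℝ) + 1) ≤ ‖f y‖ := by
    intro n
    have hp : (0 : ℝ) < 1 / ((n : ℝ) + 1) := by positivity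
    obtain ⟨y, hy, hr⟩ := (f.comp Y.subtypeL).exists_lt_apply_of_lt_opNorm
      (r := rnorm Y f - 1 / ((n : ℝ) + 1)) (by unfold rnorm; linarith)
    exact ⟨y, hy.le, hr.le⟩
  choose y hy hf using key
  refine ⟨Set.range fun n => (y n : X), Set.countable_range _, ?_, fun Z hZ => ?_⟩
  · rintro _ ⟨n, rfl⟩
    exact (y n).2
  · have h1 : ∀ n : ℕ, rnorm Y f - 1 / ((n : ℝ) + 1) ≤ rnorm Z f := fun n => by
      refine (hf n).trans ?_
      exact (f.comp Z.subtypeL).unit_le_opNorm ⟨y n, hZ ⟨n, rfl⟩⟩ (hy n)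
    have h2 : Filter.Tendsto (fun n : ℕ => rnorm Y f - 1 / ((n : ℝ) + 1)) Filter.atTop
        (nhds (rnorm Y f - 0)) := tendsto_const_nhds.sub tendsto_one_div_add_atTop_nhds_zero_nat
    simpa using le_of_tendsto' h2 h1

theorem stmt9 {X : Type*} [NormedAddCommGroup X] [NormedSpace ℝ X] [CompleteSpace X]
    (Y : Submodule ℝ X) (hY : IsClosed (Y : Set X))
    (h : ∀ Z : Submodule ℝ X, Z ≤ Y → IsClosed (Z : Set X) →
      TopologicalSpace.IsSeparable (Z : Set X) → PropSU Z) :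
    PropSU Y := by
  have hadd : ∀ f g : X →L[ℝ] ℝ, ‖f‖ = rnorm Y f → ‖g‖ = rnorm Y g →
      ‖f + g‖ = rnorm Y (f + g) := by
    intro f g hf hg
    obtain ⟨S, hSc, hSY, hS⟩ := exists_countable Y f
    obtain ⟨T, hTc, hTY, hT⟩ := exists_countable Y g
    let Z : Submodule ℝ X := (Submodule.span ℝ (S ∪ T)).topologicalClosure
    have hsub : S ∪ T ⊆ (Z : Set X) :=
      Submodule.subset_span.trans (Submodule.le_topologicalClosure _)
    have hZY : Z ≤ Y := Submodule.topologicalClosure_minimal _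
      (Submodule.span_le.2 (Set.union_subset hSY hTY)) hY
    have hZs : TopologicalSpace.IsSeparable (Z : Set X) :=
      ((hSc.union hTc).isSeparable.span (R := ℝ)).closure
    obtain ⟨G, hG⟩ := mem_iff_of_SU Z (h Z hZY (Submodule.isClosed_topologicalClosure _) hZs)
    have hfG : f ∈ G := (hG f).2 (le_antisymm
      (hf.le.trans (hS Z (Set.subset_union_left.trans hsub))) (rnorm_le Z f))
    have hgG : g ∈ G := (hG g).2 (le_antisymm
      (hg.le.trans (hT Z (Set.subset_union_right.trans hsub))) (rnorm_le Z g))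
    have := (hG _).1 (G.add_mem hfG hgG)
    exact le_antisymm (this.le.trans (rnorm_mono hZY _)) (rnorm_le Y _)
  have hz : rnorm Y 0 = 0 :=
    le_antisymm ((rnorm_le Y 0).trans norm_zero.le) (norm_nonneg ((0 : X →L[ℝ] ℝ).comp Y.subtypeL))
  have hsmul : ∀ (c : ℝ) (f : X →L[ℝ] ℝ), ‖f‖ = rnorm Y f → ‖c • f‖ = rnorm Y (c • f) := by
    intro c f hf
    rcases eq_or_ne c 0 with rfl | hc
    · simp [hz]
    have hc' : 0 < ‖c‖ := norm_pos_iff.2 hc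
    have h1 : rnorm Y f ≤ ‖c‖⁻¹ * rnorm Y (c • f) := by
      refine ContinuousLinearMap.opNorm_le_bound _ (mul_nonneg (by positivity)
        (norm_nonneg ((c • f).comp Y.subtypeL))) fun y => ?_
      have h2 : ‖(c • f) y‖ ≤ rnorm Y (c • f) * ‖y‖ :=
        ((c • f).comp Y.subtypeL).le_opNorm y
      have h3 : ‖(c • f) y‖ = ‖c‖ * ‖f y‖ := by simp
      rw [h3] at h2
      change ‖f y‖ ≤ _
      rw [mul_assoc, inv_mul_eq_div, le_div_iff₀ hc', mul_comm]
      exact h2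
    refine le_antisymm ?_ (rnorm_le Y _)
    rw [inv_mul_eq_div, le_div_iff₀ hc', mul_comm, ← hf] at h1
    rw [norm_smul]
    exact h1
  have hzero : ∀ f : X →L[ℝ] ℝ, f ∈ annih Y → rnorm Y f = 0 := by
    intro f hf
    have := rnorm_congr Y 0 f hf
    rw [zero_add] at this
    rw [this, hz]
  let G : Submodule ℝ (X →L[ℝ] ℝ) :=
    { carrier := {f | ‖f‖ = rnorm Y f}
      add_mem' := fun {f g} hf hg => hadd f g hf hg
      zero_mem' := by simp [hz]
      smul_mem' := fun c f hf => hsmul c f hf }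
  have hGm : ∀ f, f ∈ G ↔ ‖f‖ = rnorm Y f := fun f => Iff.rfl
  have hdisj : ∀ f, f ∈ G → f ∈ annih Y → f = 0 := fun f hf hf' => by
    rw [hGm, hzero f hf'] at hf
    exact norm_eq_zero.1 hf
  refine ⟨G, ?_, ⟨?_, ?_⟩, ?_⟩
  · refine isClosed_eq continuous_norm ?_
    exact continuous_norm.comp
      ((ContinuousLinearMap.compL ℝ Y X ℝ).flip Y.subtypeL).continuous
  · exact Submodule.disjoint_def.2 hdisj
  · rw [codisjoint_iff, eq_top_iff]
    intro f _
    obtain ⟨k, hk, hn⟩ := exists_hb Y f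
    refine Submodule.mem_sup.2 ⟨f + k, ?_, -k, neg_mem hk, by simp⟩
    rw [hGm, hn, rnorm_congr Y f k hk]
  · intro g hg k hk hk0
    have hle : ‖g‖ ≤ ‖g + k‖ := by
      rw [(hGm g).1 hg, ← rnorm_congr Y g k hk]
      exact rnorm_le Y _
    refine lt_of_le_of_ne hle fun he => hk0 (hdisj k ?_ hk)
    have : g + k ∈ G := by
      rw [hGm, ← he, rnorm_congr Y g k hk]
      exact hg
    simpa using G.sub_mem this hg

end
end

section
/- Let X be a real Banach space and Y a closed linear subspace of X such that every separable closed linear subspace of Y has property-(HB) in X. Then Y has property-(HB) in X. -/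
open scoped ENNReal

noncomputable section

def rs {X : Type*} [NormedAddCommGroup X] [NormedSpace ℝ X] (Z : Submodule ℝ X)
    (g : X →L[ℝ] ℝ) : Z →L[ℝ] ℝ := g.comp Z.subtypeL

def NmS {X : Type*} [NormedAddCommGroup X] [NormedSpace ℝ X] (Z : Submodule ℝ X)
    (g : X →L[ℝ] ℝ) : Prop := ‖g‖ ≤ ‖rs Z g‖

lemma restr_le {X : Type*} [NormedAddCommGroup X] [NormedSpace ℝ X] (Z : Submodule ℝ X)
    (g : X →L[ℝ] ℝ) : ‖rs Z g‖ ≤ ‖g‖ :=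
  ContinuousLinearMap.opNorm_le_bound _ (norm_nonneg _) fun z => g.le_opNorm z

lemma restr_mono {X : Type*} [NormedAddCommGroup X] [NormedSpace ℝ X] {Z Y : Submodule ℝ X}
    (hZ : Z ≤ Y) (g : X →L[ℝ] ℝ) : ‖rs Z g‖ ≤ ‖rs Y g‖ :=
  ContinuousLinearMap.opNorm_le_bound _ (ContinuousLinearMap.opNorm_nonneg _) fun z =>
    (rs Y g).le_opNorm ⟨z, hZ z.2⟩

lemma restr_add {X : Type*} [NormedAddCommGroup X] [NormedSpace ℝ X] {Z : Submodule ℝ X}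
    (g h : X →L[ℝ] ℝ) (hh : h ∈ annih Z) :
    rs Z (g + h) = rs Z g := by
  ext z
  have : h z = 0 := hh z z.2
  simp [rs, this]

lemma decomp {X : Type*} [NormedAddCommGroup X] [NormedSpace ℝ X] (Z : Submodule ℝ X)
    (f : X →L[ℝ] ℝ) : ∃ g, NmS Z g ∧ f - g ∈ annih Z := by
  obtain ⟨g, hg, hn⟩ := exists_extension_norm_eq Z (rs Z f)
  refine ⟨g, ?_, ?_⟩
  · have : rs Z g = rs Z f := by
      ext z; simpa [rs] using hg z
    unfold NmS
    rw [this, hn]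
  · intro z hz
    have := hg ⟨z, hz⟩
    simp [rs] at this
    simp [this]

lemma hb_mem {X : Type*} [NormedAddCommGroup X] [NormedSpace ℝ X] {Z : Submodule ℝ X}
    {G : Submodule ℝ (X →L[ℝ] ℝ)} (hc : IsCompl G (annih Z))
    (hG : ∀ g ∈ G, ∀ h ∈ annih Z, h ≠ 0 → ‖g‖ < ‖g + h‖ ∧ ‖h‖ ≤ ‖g + h‖)
    (g : X →L[ℝ] ℝ) : g ∈ G ↔ NmS Z g := by
  constructor
  · intro hg
    obtain ⟨f, hf, hfa⟩ := decomp Z g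
    by_cases h0 : g - f = 0
    · rw [sub_eq_zero.1 h0]; exact hf
    have hfa' : f - g ∈ annih Z := by
      rw [← neg_sub]; exact (annih Z).neg_mem hfa
    have h1 := (hG g hg (f - g) hfa' (by rw [← neg_sub]; exact neg_ne_zero.2 h0)).1
    have h2 := restr_add g (f - g) hfa'
    rw [add_sub_cancel] at h1 h2
    unfold NmS at hf ⊢
    rw [h2] at hf
    linarith
  · intro hg
    have : g ∈ G ⊔ annih Z := by rw [hc.sup_eq_top]; trivial
    obtain ⟨f, hf, h, hh, rfl⟩ := Submodule.mem_sup.1 this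
    by_cases h0 : h = 0
    · simpa [h0] using hf
    have h1 := (hG f hf h hh h0).1
    unfold NmS at hg
    rw [restr_add f h hh] at hg
    have := restr_le Z f
    linarith

lemma norming {X : Type*} [NormedAddCommGroup X] [NormedSpace ℝ X] {Y : Submodule ℝ X}
    {g : X →L[ℝ] ℝ} (hg : NmS Y g) : ∃ S : Set X, S.Countable ∧ S ⊆ Y ∧
      ∀ Z : Submodule ℝ X, S ⊆ Z → NmS Z g := by
  have : ∀ n : ℕ, ∃ y : Y, ‖y‖ < 1 ∧ ‖g‖ - 1 / ((n : ℝ) + 1) < ‖g y‖ := by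
    intro n
    have hp : (0 : ℝ) < 1 / ((n : ℝ) + 1) := by positivity
    have h1 : ‖g‖ - 1 / ((n : ℝ) + 1) < ‖rs Y g‖ := by
      unfold NmS at hg; linarith
    exact ContinuousLinearMap.exists_lt_apply_of_lt_opNorm _ h1
  choose y hy1 hy2 using this
  refine ⟨Set.range fun n => (y n : X), Set.countable_range _, ?_, ?_⟩
  · rintro _ ⟨n, rfl⟩; exact (y n).2
  · intro Z hZ
    refine le_of_forall_pos_lt_add fun ε hε => ?_
    obtain ⟨n, hn⟩ := exists_nat_one_div_lt hε
    have hz : (y n : X) ∈ Z := hZ ⟨n, rfl⟩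
    have h1 : ‖g (y n)‖ ≤ ‖rs Z g‖ :=
      (rs Z g).unit_le_opNorm ⟨y n, hz⟩ (hy1 n).le
    have := hy2 n
    linarith

lemma sepHull {X : Type*} [NormedAddCommGroup X] [NormedSpace ℝ X] {Y : Submodule ℝ X}
    (hY : IsClosed (Y : Set X)) {S : Set X} (hS : S.Countable) (hSY : S ⊆ Y) :
    ∃ Z : Submodule ℝ X, Z ≤ Y ∧ IsClosed (Z : Set X) ∧
      TopologicalSpace.IsSeparable (Z : Set X) ∧ S ⊆ Z := by
  refine ⟨(Submodule.span ℝ S).topologicalClosure,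
    Submodule.topologicalClosure_minimal _ (Submodule.span_le.2 hSY) hY,
    Submodule.isClosed_topologicalClosure _, ?_,
    Submodule.subset_span.trans (Submodule.le_topologicalClosure _)⟩
  rw [Submodule.topologicalClosure_coe]
  exact (hS.isSeparable.span (R := ℝ)).closure

theorem stmt10 {X : Type*} [NormedAddCommGroup X] [NormedSpace ℝ X] [CompleteSpace X]
    (Y : Submodule ℝ X) (hY : IsClosed (Y : Set X))
    (h : ∀ Z : Submodule ℝ X, Z ≤ Y → IsClosed (Z : Set X) →
      TopologicalSpace.IsSeparable (Z : Set X) → PropHB Z) :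
    PropHB Y := by
  have key : ∀ f g : X →L[ℝ] ℝ, NmS Y f → NmS Y g → ∃ Z : Submodule ℝ X, Z ≤ Y ∧ PropHB Z ∧
      NmS Z f ∧ NmS Z g := by
    intro f g hf hg
    obtain ⟨S, hS, hSY, hSf⟩ := norming hf
    obtain ⟨T, hT, hTY, hTg⟩ := norming hg
    obtain ⟨Z, hZY, hZc, hZs, hZ⟩ := sepHull hY (hS.union hT) (Set.union_subset hSY hTY)
    exact ⟨Z, hZY, h Z hZY hZc hZs, hSf Z (Set.subset_union_left.trans hZ),
      hTg Z (Set.subset_union_right.trans hZ)⟩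
  let G : Submodule ℝ (X →L[ℝ] ℝ) :=
    { carrier := {g | NmS Y g}
      add_mem' := by
        intro f g hf hg
        obtain ⟨Z, hZY, ⟨G, -, hc, hG⟩, hZf, hZg⟩ := key f g hf hg
        have := (hb_mem hc hG (f + g)).1
          (G.add_mem ((hb_mem hc hG f).2 hZf) ((hb_mem hc hG g).2 hZg))
        exact le_trans this (restr_mono hZY _)
      zero_mem' := by
        change ‖(0 : X →L[ℝ] ℝ)‖ ≤ _
        rw [norm_zero]
        exact ContinuousLinearMap.opNorm_nonneg _
      smul_mem' := by
        intro c f hf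
        obtain ⟨Z, hZY, ⟨G, -, hc, hG⟩, hZf, -⟩ := key f f hf hf
        have := (hb_mem hc hG (c • f)).1 (G.smul_mem c ((hb_mem hc hG f).2 hZf))
        exact le_trans this (restr_mono hZY _) }
  have memG : ∀ g, g ∈ G ↔ NmS Y g := fun g => Iff.rfl
  refine ⟨G, ?_, ?_, ?_⟩
  · refine isClosed_le continuous_norm (LipschitzWith.continuous (K := 1)
      (LipschitzWith.of_le_add fun f g => ?_))
    have h1 := ContinuousLinearMap.opNorm_nonneg (rs Y g)
    refine ContinuousLinearMap.opNorm_le_bound _ (by positivity) fun z => ?_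
    have h2 : ‖g z‖ ≤ ‖rs Y g‖ * ‖z‖ := (rs Y g).le_opNorm z
    have h3 : ‖(f - g) z‖ ≤ ‖f - g‖ * ‖z‖ := (f - g).le_opNorm z
    have h4 : ‖f z‖ ≤ ‖g z‖ + ‖(f - g) z‖ := by
      have := norm_add_le (g z) ((f - g) z)
      simpa using this
    change ‖f z‖ ≤ _
    rw [dist_eq_norm]
    linarith
  · constructor
    · rw [Submodule.disjoint_def]
      intro g hg ha
      have h1 := restr_add 0 g ha
      rw [zero_add] at h1
      have h2 := (memG g).1 hg
      unfold NmS at h2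
      rw [h1] at h2
      have e : rs Y 0 = 0 := rfl
      rw [e, ContinuousLinearMap.opNorm_zero] at h2
      exact norm_le_zero_iff.1 h2
    · rw [codisjoint_iff, eq_top_iff]
      intro f _
      obtain ⟨g, hg, ha⟩ := decomp Y f
      exact Submodule.mem_sup.2 ⟨g, hg, f - g, ha, add_sub_cancel _ _⟩
  · intro g hg a ha h0
    obtain ⟨Z, hZY, ⟨G', -, hc, hG⟩, hZg, -⟩ := key g g hg hg
    exact hG g ((hb_mem hc hG g).2 hZg) a (fun z hz => ha z (hZY hz)) h0

end
end

section
/- Let Y be a finite-dimensional linear subspace of c₀. Then Y has property-(SU) in c₀ if and only if Y has property-(U) in c₀ and Y is isometrically isomorphic to ℓ∞(dim Y). -/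
open scoped ENNReal

noncomputable section

open scoped ZeroAtInfty

lemma c0_attain (y : C₀(ℕ, ℝ)) : ∃ k, |y k| = ‖y‖ := by
  by_cases h0 : y = 0
  · exact ⟨0, by simp [h0]⟩
  have hx : ∃ x, y x ≠ 0 := by
    by_contra! h
    exact h0 (by ext x; simpa using h x)
  obtain ⟨x, hx⟩ := hx
  have ht : Filter.Tendsto (fun k => |y k|) (Filter.cocompact ℕ) (nhds 0) := by
    have := (zero_at_infty y).abs
    simpa using this
  have hc : Continuous (fun k => |y k|) := continuous_of_discreteTopology
  obtain ⟨k, hk⟩ := hc.exists_forall_ge' (x₀ := x)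
    ((ht.eventually (gt_mem_nhds (abs_pos.mpr hx))).mono fun _ h => le_of_lt h)
  refine ⟨k, le_antisymm ?_ ?_⟩
  · have := BoundedContinuousFunction.norm_coe_le_norm y.toBCF k
    simpa using this
  · rw [← ZeroAtInftyContinuousMap.norm_toBCF_eq_norm]
    exact (BoundedContinuousFunction.norm_le (abs_nonneg _)).mpr hk

lemma c0_le (y : C₀(ℕ, ℝ)) (k : ℕ) : |y k| ≤ ‖y‖ := by
  have := BoundedContinuousFunction.norm_coe_le_norm y.toBCF k
  simpa using this

def c0delta (k : ℕ) : C₀(ℕ, ℝ) →L[ℝ] ℝ :=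
  LinearMap.mkContinuous
    { toFun := fun y => y k
      map_add' := fun _ _ => rfl
      map_smul' := fun _ _ => rfl } 1 (fun y => by simpa using c0_le y k)

lemma c0delta_apply (k : ℕ) (y : C₀(ℕ, ℝ)) : c0delta k y = y k := rfl

lemma c0delta_norm (k : ℕ) : ‖c0delta k‖ ≤ 1 := LinearMap.mkContinuous_norm_le _ zero_le_one _

def c0single (k : ℕ) : C₀(ℕ, ℝ) where
  toFun := Pi.single k 1
  continuous_toFun := continuous_of_discreteTopology
  zero_at_infty' := by
    rw [Filter.cocompact_eq_cofinite, Nat.cofinite_eq_atTop]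
    refine tendsto_const_nhds.congr' ?_
    filter_upwards [Filter.eventually_gt_atTop k] with j hj
    simp [Pi.single_apply, hj.ne']

lemma c0single_apply (k j : ℕ) : c0single k j = if j = k then 1 else 0 := by
  change (Pi.single k 1 : ℕ → ℝ) j = _
  simp [Pi.single_apply]

lemma su_imp_u {X : Type*} [NormedAddCommGroup X] [NormedSpace ℝ X] (Y : Submodule ℝ X)
    (h : PropSU Y) : PropU Y := by
  obtain ⟨G, -, hc, hG⟩ := h
  intro f
  have key : ∀ F, IsNPExtension Y f F → F ∈ G := by
    intro F hF
    obtain ⟨g, hg, h, hh, rfl⟩ := Submodule.mem_sup.mp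
      (show F ∈ G ⊔ annih Y by rw [hc.sup_eq_top]; trivial)
    by_cases h0 : h = 0
    · simpa [h0] using hg
    exfalso
    have h1 := hG g hg h hh h0
    have h2 : ‖f‖ ≤ ‖g‖ := by
      refine f.opNorm_le_bound (norm_nonneg _) fun y => ?_
      rw [← hF.1 y]
      have : h y = 0 := hh y y.2
      simp only [add_apply, this, add_zero]
      exact g.le_opNorm y
    rw [hF.2] at h1
    linarith
  obtain ⟨F, hF, hFn⟩ := exists_extension_norm_eq Y f
  refine ⟨F, ⟨hF, hFn⟩, fun F' hF' => ?_⟩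
  have h1 : F' - F ∈ G := G.sub_mem (key _ hF') (key _ ⟨hF, hFn⟩)
  have h2 : F' - F ∈ annih Y := fun y hy => by
    have a := hF'.1 ⟨y, hy⟩
    have b := hF ⟨y, hy⟩
    simp only at a b
    simp [a, b]
  exact sub_eq_zero.mp (Submodule.disjoint_def.mp hc.disjoint _ h1 h2)

lemma finrank_euclid_aux (n : ℕ) : Module.finrank ℝ (PiLp ⊤ (fun _ : Fin n => ℝ)) = n := by
  rw [(WithLp.linearEquiv ⊤ ℝ (Fin n → ℝ)).finrank_eq]
  simp

lemma iso_of_indep {E K : Type*} [NormedAddCommGroup E] [NormedSpace ℝ E] [FiniteDimensional ℝ E]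
    (φ : K → Module.Dual ℝ E) (hφ : LinearIndependent ℝ φ) (h1 : ∀ k y, |φ k y| ≤ ‖y‖)
    (h2 : ∀ y, y ≠ 0 → ∃ k, |φ k y| = ‖y‖) :
    Nonempty (E ≃ₗᵢ[ℝ] PiLp ⊤ (fun _ : Fin (Module.finrank ℝ E) => ℝ)) := by
  have : Finite K := hφ.finite
  have : Fintype K := Fintype.ofFinite K
  have hcard1 : Fintype.card K ≤ Module.finrank ℝ E := by
    have := hφ.fintype_card_le_finrank
    rwa [Subspace.dual_finrank_eq] at this
  let T : E →ₗ[ℝ] (K → ℝ) := LinearMap.pi φ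
  have hT : ∀ y k, T y k = φ k y := fun _ _ => rfl
  have hTn : ∀ y, ‖T y‖ = ‖y‖ := by
    intro y
    apply le_antisymm
    · exact (pi_norm_le_iff_of_nonneg (norm_nonneg _)).mpr fun k => h1 k y
    · by_cases h0 : y = 0
      · simp [h0]
      obtain ⟨k, hk⟩ := h2 y h0
      have := norm_le_pi_norm (T y) k
      rw [hT, Real.norm_eq_abs, hk] at this
      exact this
  have hTi : Function.Injective T := (injective_iff_map_eq_zero T).mpr fun y hy => by
    have := hTn y
    rw [hy, norm_zero] at this
    exact norm_eq_zero.mp this.symm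
  have hcard2 : Module.finrank ℝ E ≤ Fintype.card K := by
    simpa using LinearMap.finrank_le_finrank_of_injective hTi
  have hcard : Fintype.card K = Module.finrank ℝ E := le_antisymm hcard1 hcard2
  let e : K ≃ Fin (Module.finrank ℝ E) := Fintype.equivFinOfCardEq hcard
  let S : E →ₗᵢ[ℝ] PiLp ⊤ (fun _ : Fin (Module.finrank ℝ E) => ℝ) :=
    { toLinearMap := (WithLp.linearEquiv ⊤ ℝ _).symm.toLinearMap ∘ₗ
        (LinearEquiv.funCongrLeft ℝ ℝ e.symm).toLinearMap ∘ₗ T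
      norm_map' := fun y => by
        rw [← hTn y, PiLp.norm_eq_ciSup]
        change (⨆ i, ‖T y (e.symm i)‖) = _
        apply le_antisymm
        · exact Real.iSup_le (fun i => norm_le_pi_norm (T y) _) (norm_nonneg _)
        · refine (pi_norm_le_iff_of_nonneg (Real.iSup_nonneg fun i => norm_nonneg _)).mpr
            fun k => ?_
          have := le_ciSup (f := fun i => ‖T y (e.symm i)‖) (Set.finite_range _).bddAbove (e k)
          simpa using this }
  exact ⟨S.toLinearIsometryEquiv (finrank_euclid_aux _).symm⟩

lemma su_imp_iso_gen {X : Type*} [NormedAddCommGroup X] [NormedSpace ℝ X] (d : ℕ → X →L[ℝ] ℝ)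
    (b : ℕ → X) (hd : ∀ k, ‖d k‖ ≤ 1) (hb : ∀ k j, d j (b k) = if j = k then 1 else 0)
    (hatt : ∀ y, ∃ k, |d k y| = ‖y‖)
    (Y : Submodule ℝ X) [FiniteDimensional ℝ Y] (h : PropSU Y) :
    Nonempty (Y ≃ₗᵢ[ℝ] PiLp ⊤ (fun _ : Fin (Module.finrank ℝ Y) => ℝ)) := by
  obtain ⟨G, -, hc, hG⟩ := h
  let K : Set ℕ := {k | ∃ y ∈ Y, y ≠ 0 ∧ |d k y| = ‖y‖}
  have hK : ∀ k ∈ K, d k ∈ G := by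
    rintro k ⟨y, hy, hy0, hyk⟩
    obtain ⟨g, hg, h, hh, hgh⟩ := Submodule.mem_sup.mp
      (show d k ∈ G ⊔ annih Y by rw [hc.sup_eq_top]; trivial)
    by_cases h0 : h = 0
    · rw [← hgh]; simpa [h0] using hg
    exfalso
    have h1 := hG g hg h hh h0
    rw [hgh] at h1
    have h2 := hd k
    have h3 := g.le_opNorm y
    have h4 : g y = d k y := by
      rw [← hgh, add_apply, hh y hy, add_zero]
    rw [h4, Real.norm_eq_abs, hyk] at h3
    have h5 : 0 < ‖y‖ := norm_pos_iff.mpr hy0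
    nlinarith
  let φ : K → Module.Dual ℝ Y := fun k => (d k).toLinearMap ∘ₗ Y.subtype
  have hφ : LinearIndependent ℝ φ := by
    rw [linearIndependent_iff']
    intro s a hs i hi
    have h1 : ∑ k ∈ s, a k • d k ∈ G :=
      G.sum_mem fun k _ => G.smul_mem _ (hK k k.2)
    have h2 : ∑ k ∈ s, a k • d k ∈ annih Y := fun y hy => by
      have := LinearMap.congr_fun hs ⟨y, hy⟩
      simpa [φ] using this
    have h3 := Submodule.disjoint_def.mp hc.disjoint _ h1 h2
    have h4 := congrArg (fun F : X →L[ℝ] ℝ => F (b i)) h3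
    simpa [hb, Subtype.val_inj, hi] using h4
  refine iso_of_indep φ hφ (fun k y => ?_) fun y h0 => ?_
  · exact ((d k).le_opNorm y).trans (mul_le_of_le_one_left (norm_nonneg _) (hd k))
  obtain ⟨k, hk⟩ := hatt y
  exact ⟨⟨k, y, y.2, by simpa using h0, hk⟩, hk⟩

lemma su_imp_iso (Y : Submodule ℝ C₀(ℕ, ℝ)) [FiniteDimensional ℝ Y] (h : PropSU Y) :
    Nonempty (Y ≃ₗᵢ[ℝ] PiLp ⊤ (fun _ : Fin (Module.finrank ℝ Y) => ℝ)) :=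
  su_imp_iso_gen c0delta c0single c0delta_norm (fun k j => c0single_apply k j) c0_attain Y h

lemma u_iso_imp_su {X : Type*} [NormedAddCommGroup X] [NormedSpace ℝ X] (Y : Submodule ℝ X)
    {n : ℕ} (hU : PropU Y) (e : Y ≃ₗᵢ[ℝ] PiLp ⊤ (fun _ : Fin n => ℝ)) : PropSU Y := by
  have hcoord : ∀ (v : PiLp ⊤ (fun _ : Fin n => ℝ)) i, ‖v i‖ ≤ ‖v‖ := fun v i =>
    PiLp.norm_apply_le v i
  let f : Fin n → Y →L[ℝ] ℝ := fun i => LinearMap.mkContinuous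
    { toFun := fun y => e y i
      map_add' := fun _ _ => by simp
      map_smul' := fun _ _ => by simp } 1 (fun y => by
        simpa using hcoord (e y) i)
  have hfa : ∀ i y, f i y = e y i := fun _ _ => rfl
  have hfn : ∀ i, ‖f i‖ ≤ 1 := fun i => LinearMap.mkContinuous_norm_le _ zero_le_one _
  choose F hF hF' using fun i => hU (f i)
  let L : (Fin n → ℝ) →ₗ[ℝ] (X →L[ℝ] ℝ) := Fintype.linearCombination ℝ F
  have hL : ∀ a, L a = ∑ i, a i • F i := fun a => rfl
  have hLY : ∀ a (y : Y), L a y = ∑ i, a i * e y i := by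
    intro a y
    rw [hL]
    simp [(hF _).1 y, hfa]
  have hNP : ∀ a, IsNPExtension Y ((L a).comp Y.subtypeL) (L a) := by
    intro a
    refine ⟨fun y => rfl, le_antisymm ?_ ?_⟩
    · have h1 : ‖L a‖ ≤ ∑ i, |a i| := by
        rw [hL]
        refine (norm_sum_le _ _).trans (Finset.sum_le_sum fun i _ => ?_)
        rw [norm_smul, (hF i).2, Real.norm_eq_abs]
        exact mul_le_of_le_one_right (abs_nonneg _) (hfn i)
      let v : PiLp ⊤ (fun _ : Fin n => ℝ) := WithLp.toLp ⊤ fun i => (SignType.sign (a i) : ℝ)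
      have hv : ‖v‖ ≤ 1 := by
        rw [PiLp.norm_eq_ciSup]
        refine Real.iSup_le (fun i => ?_) zero_le_one
        change ‖(SignType.sign (a i) : ℝ)‖ ≤ 1
        cases SignType.sign (a i) <;> simp
      have h2 : ((L a).comp Y.subtypeL) (e.symm v) = ∑ i, |a i| := by
        change L a (e.symm v : Y) = _
        rw [hLY]
        refine Finset.sum_congr rfl fun i _ => ?_
        rw [e.apply_symm_apply]
        exact self_mul_sign (a i)
      have h3 := ((L a).comp Y.subtypeL).le_opNorm (e.symm v)
      rw [h2, e.symm.norm_map] at h3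
      have h4 := (le_abs_self _).trans h3
      have h5 := mul_le_of_le_one_right (norm_nonneg ((L a).comp Y.subtypeL)) hv
      linarith
    · refine ContinuousLinearMap.opNorm_le_bound _ (norm_nonneg _) fun y => ?_
      exact (L a).le_opNorm y
  refine ⟨LinearMap.range L, Submodule.closed_of_finiteDimensional _, ⟨?_, ?_⟩, ?_⟩
  · rw [Submodule.disjoint_def]
    rintro _ ⟨a, rfl⟩ ha
    have : (L a).comp Y.subtypeL = 0 := by
      ext y; exact ha y y.2
    have h1 := (hNP a).2
    rw [this, ContinuousLinearMap.opNorm_zero] at h1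
    exact norm_eq_zero.mp h1
  · rw [codisjoint_iff, eq_top_iff]
    intro H _
    let a : Fin n → ℝ := fun i => H (e.symm (WithLp.toLp ⊤ (Pi.single i 1)) : Y)
    refine Submodule.mem_sup.mpr ⟨L a, ⟨a, rfl⟩, H - L a, ?_, by abel⟩
    intro y hy
    have h1 : (⟨y, hy⟩ : Y) = ∑ i, e ⟨y, hy⟩ i • e.symm (WithLp.toLp ⊤ (Pi.single i 1)) := by
      apply e.injective
      rw [map_sum]
      ext j
      simp [Pi.single_apply]
    have h2 := congrArg (fun z : Y => H z) h1
    have h3 := hLY a ⟨y, hy⟩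
    simp only [Submodule.coe_sum, Submodule.coe_smul, map_sum, map_smul, smul_eq_mul] at h2
    rw [sub_apply, sub_eq_zero, h2, h3]
    exact Finset.sum_congr rfl fun i _ => mul_comm _ _
  · rintro _ ⟨a, rfl⟩ h hh h0
    have hr : ∀ y : Y, (L a + h) y = ((L a).comp Y.subtypeL) y := fun y => by
      simp [hh y y.2]
    refine lt_of_le_of_ne ?_ ?_
    · rw [(hNP a).2]
      refine ContinuousLinearMap.opNorm_le_bound _ (norm_nonneg _) fun y => ?_
      rw [← hr]
      exact (L a + h).le_opNorm y
    · intro heq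
      have := (hU _).unique (hNP a) ⟨hr, heq.symm.trans (hNP a).2⟩
      exact h0 (by simpa using this)

theorem stmt12 (Y : Submodule ℝ C₀(ℕ, ℝ)) [FiniteDimensional ℝ Y] :
    PropSU Y ↔
      PropU Y ∧ Nonempty (Y ≃ₗᵢ[ℝ] PiLp ⊤ (fun _ : Fin (Module.finrank ℝ Y) => ℝ)) :=
  ⟨fun h => ⟨su_imp_u Y h, su_imp_iso Y h⟩, fun ⟨hU, ⟨e⟩⟩ => u_iso_imp_su Y hU e⟩

end
end

section
/- Let Y be a finite-dimensional linear subspace of ℓ₁. Then Y has property-(HB) in ℓ₁ if and only if Y has property-(U) in ℓ₁ and there exists a bi-contractive linear projection P : ℓ₁ → ℓ₁ with range P = Y such that Y is isometrically isomorphic to ℓ₁(dim Y) and (I − P)(ℓ₁) is isometrically isomorphic to ℓ₁. -/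
open scoped ENNReal

noncomputable section

abbrev L1 := lp (fun _ : ℕ => ℝ) 1

lemma l1_hasSum (x : L1) : HasSum (fun i => |x i|) ‖x‖ := by
  have := lp.hasSum_norm (p := 1) (by simp) x
  simpa using this

lemma l1_decay (p : L1) (j : ℕ) (h : ‖lp.single 1 j (1 : ℝ) - p‖ ≤ 1) : ‖p‖ ≤ 2 * |p j| := by
  have h1 := (l1_hasSum p).sub (l1_hasSum (lp.single 1 j (1 : ℝ) - p))
  have h2 := hasSum_single (f := fun i => |p i| - |(lp.single 1 j (1 : ℝ) - p : L1) i|) j (by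
    intro i hi
    simp [lp.coeFn_sub, hi])
  have h3 := h1.unique h2
  simp only [lp.coeFn_sub, Pi.sub_apply, lp.single_apply_self] at h3
  have h4 : 1 - |p j| ≤ |1 - p j| := by
    have := abs_sub_abs_le_abs_sub 1 (p j)
    simpa using this
  linarith

lemma l1_opNorm_le (F : L1 →L[ℝ] ℝ) (C : ℝ) (hC : 0 ≤ C)
    (h : ∀ j, |F (lp.single 1 j (1 : ℝ))| ≤ C) : ‖F‖ ≤ C := by
  refine F.opNorm_le_bound hC fun x => ?_
  have h1 := (lp.hasSum_single (p := 1) (by simp) x).mapL F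
  have h2 := (l1_hasSum x).mul_left C
  rw [← h1.tsum_eq]
  refine tsum_of_norm_bounded h2 fun j => ?_
  have : (lp.single 1 j (x j) : L1) = (x j) • lp.single 1 j (1 : ℝ) := by
    rw [← lp.single_smul]; simp
  rw [this, map_smul, smul_eq_mul, Real.norm_eq_abs, abs_mul, mul_comm]
  exact mul_le_mul_of_nonneg_right (h j) (abs_nonneg _)

lemma core (Y : Submodule ℝ L1) [FiniteDimensional ℝ Y] (P : L1 →L[ℝ] L1)
    (hPY : ∀ x, P x ∈ Y) (hP : ∀ y ∈ Y, P y = y) (n1 : ‖P‖ ≤ 1)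
    (n2 : ‖ContinuousLinearMap.id ℝ L1 - P‖ ≤ 1) (U : PropU Y) : Y = ⊥ := by
  by_contra hY
  have hnt : Nontrivial Y := Y.nontrivial_iff_ne_bot.2 hY
  have he : ∀ j, ‖(lp.single 1 j (1 : ℝ) : L1)‖ = 1 := fun j => by
    rw [lp.norm_single (by simp)]; simp
  have hPe : ∀ j, ‖P (lp.single 1 j (1 : ℝ))‖ ≤ 1 := fun j => by
    simpa [he] using P.le_of_opNorm_le n1 (lp.single 1 j (1 : ℝ))
  have hd : ∀ j, ‖P (lp.single 1 j (1 : ℝ))‖ ≤ 2 * |P (lp.single 1 j (1 : ℝ)) j| := fun j =>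
    l1_decay _ j (by
      simpa [he] using (ContinuousLinearMap.id ℝ L1 - P).le_of_opNorm_le n2 (lp.single 1 j (1 : ℝ)))
  -- decay
  let b := Module.finBasis ℝ Y
  let g : Fin (Module.finrank ℝ Y) → (Y →L[ℝ] ℝ) := fun i => LinearMap.toContinuousLinearMap (b.coord i)
  have hb : ∀ y : Y, ∀ j, |(y : L1) j| ≤ ‖y‖ * ∑ i, ‖g i‖ * |(b i : L1) j| := by
    intro y j
    have h0 : (y : L1) j = ∑ i, g i y * (b i : L1) j := by
      have h := congrArg (fun z : Y => lp.evalCLM ℝ (fun _ : ℕ => ℝ) 1 j (z : L1)) (b.sum_repr y)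
      simp only [Submodule.coe_sum, map_sum, Submodule.coe_smul, map_smul] at h
      exact h.symm
    rw [h0, Finset.mul_sum]
    refine (Finset.abs_sum_le_sum_abs _ _).trans (Finset.sum_le_sum fun i _ => ?_)
    rw [abs_mul, ← mul_assoc, mul_comm ‖y‖]
    exact mul_le_mul_of_nonneg_right ((g i).le_opNorm y) (abs_nonneg _)
  have ht : Filter.Tendsto (fun j => ∑ i, ‖g i‖ * |(b i : L1) j|) Filter.atTop (nhds 0) := by
    have : Filter.Tendsto (fun j => ∑ i, ‖g i‖ * |(b i : L1) j|) Filter.atTop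
        (nhds (∑ i, ‖g i‖ * 0)) :=
      tendsto_finsetSum _ fun i _ =>
        ((l1_hasSum (b i : L1)).summable.tendsto_atTop_zero).const_mul _
    simpa using this
  obtain ⟨N, hN⟩ := Filter.eventually_atTop.1
    (ht.eventually (gt_mem_nhds (show (0 : ℝ) < 1 / 4 by norm_num)))
  have hsmall : ∀ j, N ≤ j → ‖P (lp.single 1 j (1 : ℝ))‖ ≤ 1 / 2 := by
    intro j hj
    have h1 := hb ⟨_, hPY (lp.single 1 j (1 : ℝ))⟩ j
    have h2 := hN j hj
    have h3 := hPe j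
    have h4 := hd j
    have h5 : 0 ≤ ∑ i, ‖g i‖ * |(b i : L1) j| := Finset.sum_nonneg fun i _ => by positivity
    simp only [Submodule.coe_norm] at h1
    nlinarith
  -- annihilating functional
  let n := Module.finrank ℝ Y
  let ev : ℕ → (L1 →L[ℝ] ℝ) := fun j => lp.evalCLM ℝ (fun _ : ℕ => ℝ) 1 j
  let T : (Fin (n + 1) → ℝ) →ₗ[ℝ] (Y →ₗ[ℝ] ℝ) :=
    Fintype.linearCombination ℝ (fun k : Fin (n + 1) => (ev (N + k)).toLinearMap.comp Y.subtype)
  have hker : LinearMap.ker T ≠ ⊥ := by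
    apply LinearMap.ker_ne_bot_of_finrank_lt
    have : Module.finrank ℝ (Y →ₗ[ℝ] ℝ) = n := by
      simp [n]
    rw [this]; simp
  obtain ⟨c, hc, hc0⟩ := (Submodule.ne_bot_iff _).1 hker
  let d : ℝ := 1 / (2 * ‖c‖)
  have hcn : 0 < ‖c‖ := norm_pos_iff.2 hc0
  have hdpos : 0 < d := by positivity
  let H : L1 →L[ℝ] ℝ := ∑ k : Fin (n + 1), (d * c k) • ev (N + k)
  have hHY : ∀ y ∈ Y, H y = 0 := by
    intro y hy
    have h := LinearMap.congr_fun (LinearMap.mem_ker.1 hc) ⟨y, hy⟩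
    simp only [T, Fintype.linearCombination_apply, LinearMap.sum_apply, LinearMap.smul_apply,
      LinearMap.comp_apply, Submodule.subtype_apply, LinearMap.zero_apply, smul_eq_mul] at h
    simp only [H, ContinuousLinearMap.sum_apply, ContinuousLinearMap.smul_apply, smul_eq_mul,
      mul_assoc, ← Finset.mul_sum]
    exact mul_eq_zero_of_right _ h
  have hHe : ∀ j, H (lp.single 1 j (1 : ℝ)) =
      ∑ k : Fin (n + 1), if N + (k : ℕ) = j then d * c k else 0 := by
    intro j
    simp only [H, ContinuousLinearMap.sum_apply, ContinuousLinearMap.smul_apply, smul_eq_mul]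
    refine Finset.sum_congr rfl fun k _ => ?_
    change d * c k * (lp.single 1 j (1 : ℝ) : L1) (N + k) = _
    by_cases hk : N + (k : ℕ) = j
    · rw [hk]; simp
    · rw [lp.single_apply_ne _ _ _ hk]; simp [hk]
  have hHk : ∀ k : Fin (n + 1), H (lp.single 1 (N + k) (1 : ℝ)) = d * c k := by
    intro k
    rw [hHe, Finset.sum_eq_single k]
    · simp
    · intro l _ hl
      rw [if_neg]
      intro h
      exact hl (Fin.ext (by omega))
    · simp
  have hHj : ∀ j, (∀ k : Fin (n + 1), N + (k : ℕ) ≠ j) → H (lp.single 1 j (1 : ℝ)) = 0 := by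
    intro j hj
    rw [hHe]
    exact Finset.sum_eq_zero fun k _ => if_neg (hj k)
  have hHne : H ≠ 0 := by
    intro h
    apply hc0
    ext k
    have := hHk k
    rw [h] at this
    simpa [hdpos.ne'] using this.symm
  obtain ⟨y0, hy0⟩ := exists_ne (0 : Y)
  obtain ⟨f, hf1, -⟩ := exists_dual_vector ℝ y0 (by simpa using hy0)
  let Pc : L1 →L[ℝ] Y := P.codRestrict Y hPY
  let F : L1 →L[ℝ] ℝ := f.comp Pc
  have hFY : ∀ y : Y, F y = f y := by
    intro y
    change f (Pc y) = f y
    congr 1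
    exact Subtype.ext (hP y y.2)
  have hFe : ∀ j, |F (lp.single 1 j (1 : ℝ))| ≤ ‖P (lp.single 1 j (1 : ℝ))‖ := by
    intro j
    have := f.le_opNorm (Pc (lp.single 1 j (1 : ℝ)))
    rw [hf1, one_mul] at this
    exact this
  have key : ∀ F' : L1 →L[ℝ] ℝ, (∀ y : Y, F' y = f y) →
      (∀ j, |F' (lp.single 1 j (1 : ℝ))| ≤ 1) → IsNPExtension Y f F' := by
    intro F' h1 h2
    refine ⟨h1, le_antisymm (by rw [hf1]; exact l1_opNorm_le _ _ zero_le_one h2) ?_⟩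
    refine f.opNorm_le_bound (norm_nonneg _) fun y => ?_
    rw [← h1]
    exact F'.le_opNorm y
  have e1 := key F hFY fun j => (hFe j).trans (hPe j)
  have e2 := key (F + H) (fun y => by
      rw [ContinuousLinearMap.add_apply, hHY y y.2, hFY, add_zero]) (fun j => by
    rw [ContinuousLinearMap.add_apply]
    by_cases hj : ∃ k : Fin (n + 1), N + (k : ℕ) = j
    · obtain ⟨k, rfl⟩ := hj
      have h1 := (hFe (N + k)).trans (hsmall (N + k) (by omega))
      have h2 : |d * c k| ≤ 1 / 2 := by
        have h3 : |c k| ≤ ‖c‖ := norm_le_pi_norm c k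
        rw [abs_mul, abs_of_pos hdpos]
        calc d * |c k| ≤ d * ‖c‖ := by gcongr
          _ = 1 / 2 := by simp only [d]; field_simp
      rw [hHk]
      refine (abs_add_le _ _).trans ?_
      linarith
    · push Not at hj
      rw [hHj j hj, add_zero]
      exact (hFe j).trans (hPe j))
  have := (U f).unique e1 e2
  exact hHne (by simpa using this)

lemma hb_imp (Y : Submodule ℝ L1) [FiniteDimensional ℝ Y] (h : PropHB Y) : Y = ⊥ := by
  obtain ⟨G, -, hcompl, hG⟩ := h
  have hdec : ∀ F : L1 →L[ℝ] ℝ, ∃ g ∈ G, ∃ h ∈ annih Y, g + h = F := fun F =>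
    Submodule.mem_sup.1 (hcompl.sup_eq_top ▸ Submodule.mem_top)
  have huniq : ∀ g ∈ G, (∀ y ∈ Y, g y = 0) → g = 0 := fun g hg h =>
    (Submodule.disjoint_def.1 hcompl.disjoint) g hg h
  have hU : PropU Y := by
    intro f
    obtain ⟨F, hF1, hF2⟩ := exists_extension_norm_eq Y f
    have hin : ∀ F, IsNPExtension Y f F → F ∈ G := by
      rintro F ⟨h1, h2⟩
      obtain ⟨g, hg, h, hh, rfl⟩ := hdec F
      by_cases h0 : h = 0
      · simpa [h0] using hg
      · exfalso
        have h3 := (hG g hg h hh h0).1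
        have h4 : ‖f‖ ≤ ‖g‖ := f.opNorm_le_bound (norm_nonneg _) fun y => by
          have : g y = f y := by
            rw [← h1, ContinuousLinearMap.add_apply, hh y y.2, add_zero]
          rw [← this]
          exact g.le_opNorm y
        linarith
    refine ⟨F, ⟨hF1, hF2⟩, fun F' hF' => ?_⟩
    have := huniq (F' - F) (G.sub_mem (hin _ hF') (hin _ ⟨hF1, hF2⟩)) fun y hy => by
      have h1 := hF'.1 ⟨y, hy⟩
      have h2 := hF1 ⟨y, hy⟩
      simp only at h1 h2
      rw [ContinuousLinearMap.sub_apply, h1, h2, sub_self]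
    exact sub_eq_zero.1 this
  let b := Module.finBasis ℝ Y
  have hg : ∀ i, ∃ g ∈ G, ∀ y : Y, g y = b.coord i y := by
    intro i
    obtain ⟨F, hF1, -⟩ := exists_extension_norm_eq Y (LinearMap.toContinuousLinearMap (b.coord i))
    obtain ⟨g, hg, h, hh, rfl⟩ := hdec F
    refine ⟨g, hg, fun y => ?_⟩
    have := hF1 y
    rw [ContinuousLinearMap.add_apply, hh y y.2, add_zero] at this
    exact this
  choose g hgG hgY using hg
  let P : L1 →L[ℝ] L1 := ∑ i, (g i).smulRight (b i : L1)
  have hPx : ∀ x, P x = ∑ i, g i x • (b i : L1) := by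
    intro x
    simp [P, ContinuousLinearMap.sum_apply]
  have hP : ∀ y ∈ Y, P y = y := by
    intro y hy
    rw [hPx]
    have := congrArg (fun z : Y => (z : L1)) (b.sum_repr ⟨y, hy⟩)
    simp only [Submodule.coe_sum, Submodule.coe_smul] at this
    refine Eq.trans (Finset.sum_congr rfl fun i _ => ?_) this
    rw [hgY i ⟨y, hy⟩]; rfl
  have hPY : ∀ x, P x ∈ Y := fun x => by
    rw [hPx]
    exact Y.sum_mem fun i _ => Y.smul_mem _ (b i).2
  have hcG : ∀ F : L1 →L[ℝ] ℝ, F.comp P ∈ G := by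
    intro F
    have : F.comp P = ∑ i, F (b i) • g i := by
      ext x
      simp [hPx, ContinuousLinearMap.sum_apply, mul_comm]
    rw [this]
    exact G.sum_mem fun i _ => G.smul_mem _ (hgG i)
  have hcA : ∀ F : L1 →L[ℝ] ℝ, F - F.comp P ∈ annih Y := by
    intro F y hy
    simp [hP y hy]
  have hn : ∀ F : L1 →L[ℝ] ℝ, ‖F.comp P‖ ≤ ‖F‖ ∧ ‖F - F.comp P‖ ≤ ‖F‖ := by
    intro F
    by_cases h0 : F - F.comp P = 0
    · rw [h0]
      rw [← sub_eq_zero.1 h0]; simp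
    · have := hG _ (hcG F) _ (hcA F) h0
      rw [add_sub_cancel] at this
      exact ⟨this.1.le, this.2⟩
  refine core Y P hPY hP ?_ ?_ hU
  · refine P.opNorm_le_bound zero_le_one fun x => ?_
    obtain ⟨F, hF1, hF2⟩ := exists_dual_vector'' ℝ (P x)
    have h1 := (F.comp P).le_opNorm x
    have h2 : (F.comp P) x = ‖P x‖ := hF2
    rw [h2, norm_norm] at h1
    exact h1.trans (mul_le_mul_of_nonneg_right ((hn F).1.trans hF1) (norm_nonneg _))
  · refine ContinuousLinearMap.opNorm_le_bound _ zero_le_one fun x => ?_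
    obtain ⟨F, hF1, hF2⟩ := exists_dual_vector'' ℝ ((ContinuousLinearMap.id ℝ L1 - P) x)
    have h1 := (F - F.comp P).le_opNorm x
    have h2 : (F - F.comp P) x = ‖(ContinuousLinearMap.id ℝ L1 - P) x‖ := by
      rw [show (F - F.comp P) x = F ((ContinuousLinearMap.id ℝ L1 - P) x) by simp]
      exact hF2
    rw [h2, norm_norm] at h1
    exact h1.trans (mul_le_mul_of_nonneg_right ((hn F).2.trans hF1) (norm_nonneg _))

theorem stmt15 (Y : Submodule ℝ (lp (fun _ : ℕ => ℝ) 1)) [FiniteDimensional ℝ Y] :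
    PropHB Y ↔
      PropU Y ∧ ∃ P : lp (fun _ : ℕ => ℝ) 1 →L[ℝ] lp (fun _ : ℕ => ℝ) 1,
        P.comp P = P ∧ ‖P‖ ≤ 1 ∧
        ‖ContinuousLinearMap.id ℝ (lp (fun _ : ℕ => ℝ) 1) - P‖ ≤ 1 ∧
        LinearMap.range P.toLinearMap = Y ∧
        Nonempty (Y ≃ₗᵢ[ℝ] PiLp 1 (fun _ : Fin (Module.finrank ℝ Y) => ℝ)) ∧
        Nonempty (↥(LinearMap.range
            (ContinuousLinearMap.id ℝ (lp (fun _ : ℕ => ℝ) 1) - P).toLinearMap) ≃ₗᵢ[ℝ]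
          lp (fun _ : ℕ => ℝ) 1) := by
  constructor
  · intro h
    have hY := hb_imp Y h
    subst hY
    refine ⟨?_, 0, ?_, ?_, ?_, ?_, ?_, ?_⟩
    · intro f
      have hf : f = 0 := by
        ext y
        rw [Subsingleton.elim y 0]; simp
      subst hf
      refine ⟨0, ⟨by simp, by simp⟩, ?_⟩
      rintro F ⟨-, hF⟩
      simpa using hF
    · simp
    · simp
    · rw [sub_zero]
      exact ContinuousLinearMap.norm_id_le
    · simp
    · have h0 : Module.finrank ℝ (⊥ : Submodule ℝ (lp (fun _ : ℕ => ℝ) 1)) = 0 := finrank_bot _ _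
      have : IsEmpty (Fin (Module.finrank ℝ (⊥ : Submodule ℝ (lp (fun _ : ℕ => ℝ) 1)))) := by
        rw [h0]; infer_instance
      have hs : Subsingleton (PiLp 1
          (fun _ : Fin (Module.finrank ℝ (⊥ : Submodule ℝ (lp (fun _ : ℕ => ℝ) 1))) => ℝ)) :=
        ⟨fun a b => by ext i; exact this.elim i⟩
      exact ⟨{ (0 : (⊥ : Submodule ℝ (lp (fun _ : ℕ => ℝ) 1)) ≃ₗ[ℝ] PiLp 1
          (fun _ : Fin (Module.finrank ℝ (⊥ : Submodule ℝ (lp (fun _ : ℕ => ℝ) 1))) => ℝ)) with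
        norm_map' := fun x => by rw [Subsingleton.elim x 0]; simp }⟩
    · refine ⟨LinearIsometryEquiv.ofTop _ _ ?_⟩
      rw [sub_zero]
      exact LinearMap.range_id
  · rintro ⟨hU, P, hPP, n1, n2, hr, -, -⟩
    have hY : Y = ⊥ := by
      refine core Y P (fun x => hr ▸ LinearMap.mem_range_self P.toLinearMap x) ?_ n1 n2 hU
      intro y hy
      rw [← hr] at hy
      obtain ⟨x, rfl⟩ := hy
      exact DFunLike.congr_fun hPP x
    subst hY
    refine ⟨⊥, ?_, ?_, ?_⟩
    · simp
    · have : annih (⊥ : Submodule ℝ (lp (fun _ : ℕ => ℝ) 1)) = ⊤ := by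
        rw [eq_top_iff]
        intro f _ y hy
        rw [(Submodule.mem_bot ℝ).1 hy, map_zero]
      rw [this]
      exact isCompl_bot_top
    · intro g hg h _ h0
      rw [(Submodule.mem_bot ℝ).1 hg]
      simpa using h0

end
end
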